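/- arXiv:2304.09597 — 5 statements merged into one kernel-verified Lean document; each statement's English description precedes it below -/
import Mathlib

section
/- Let a₁, a₂ > 0, let φ₁, φ₂ : ℝ → ℂ be continuous functions, and let c₁, c₂ ≥ 0 be constants such that |φᵢ(t)| ≤ cᵢ e^{−t²/aᵢ} for all t ∈ ℝ and i = 1, 2. Then the convolution φ₁⋆φ₂ is defined everywhere and satisfies |(φ₁⋆φ₂)(x)| ≤ c₁ c₂ · (√π · √(a₁a₂) / √(a₁+a₂)) · e^{−x²/(a₁+a₂)} for every x ∈ ℝ. (Equivalently, p_{a₁+a₂}(φ₁⋆φ₂) ≤ (√π √(a₁a₂)/√(a₁+a₂)) p_{a₁}(φ₁) p_{a₂}(φ₂), where p_a(φ) = sup_{t∈ℝ} |φ(t)| e^{t²/a}.) -/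
open Complex MeasureTheory

noncomputable section

theorem stmt4 (a₁ a₂ : ℝ) (ha₁ : 0 < a₁) (ha₂ : 0 < a₂)
    (φ₁ φ₂ : ℝ → ℂ) (hφ₁ : Continuous φ₁) (hφ₂ : Continuous φ₂)
    (c₁ c₂ : ℝ) (hc₁ : 0 ≤ c₁) (hc₂ : 0 ≤ c₂)
    (hb₁ : ∀ t : ℝ, ‖φ₁ t‖ ≤ c₁ * Real.exp (-t ^ 2 / a₁))
    (hb₂ : ∀ t : ℝ, ‖φ₂ t‖ ≤ c₂ * Real.exp (-t ^ 2 / a₂)) :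
    ∀ x : ℝ, Integrable (fun t : ℝ => φ₁ (x - t) * φ₂ t) ∧
      ‖∫ t : ℝ, φ₁ (x - t) * φ₂ t‖ ≤
        c₁ * c₂ * (Real.sqrt Real.pi * Real.sqrt (a₁ * a₂) / Real.sqrt (a₁ + a₂)) *
          Real.exp (-x ^ 2 / (a₁ + a₂)) := by
  intro x
  have hs : 0 < a₁ + a₂ := by positivity
  have hb : 0 < (a₁ + a₂) / (a₁ * a₂) := by positivity
  set b := (a₁ + a₂) / (a₁ * a₂) with hbdef
  set m := x * a₂ / (a₁ + a₂) with hm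
  set G : ℝ → ℝ := fun t => c₁ * c₂ * Real.exp (-x ^ 2 / (a₁ + a₂)) *
    Real.exp (-b * (t - m) ^ 2) with hG
  have hGi : Integrable G :=
    ((integrable_exp_neg_mul_sq hb).comp_sub_right m).const_mul _
  have hle : ∀ t : ℝ, ‖φ₁ (x - t) * φ₂ t‖ ≤ G t := by
    intro t
    have h : G t = (c₁ * Real.exp (-(x - t) ^ 2 / a₁)) * (c₂ * Real.exp (-t ^ 2 / a₂)) := by
      have e : Real.exp (-x ^ 2 / (a₁ + a₂)) * Real.exp (-b * (t - m) ^ 2) =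
          Real.exp (-(x - t) ^ 2 / a₁) * Real.exp (-t ^ 2 / a₂) := by
        rw [← Real.exp_add, ← Real.exp_add]
        congr 1
        rw [hbdef, hm]
        field_simp
        ring
      simp only [hG]
      rw [mul_assoc (c₁ * c₂), e]
      ring
    rw [h, norm_mul]
    exact mul_le_mul (hb₁ _) (hb₂ _) (norm_nonneg _) (by positivity)
  have hint : Integrable (fun t : ℝ => φ₁ (x - t) * φ₂ t) :=
    hGi.mono' (by fun_prop) (Filter.Eventually.of_forall hle)
  refine ⟨hint, ?_⟩
  refine (norm_integral_le_of_norm_le hGi (Filter.Eventually.of_forall hle)).trans (le_of_eq ?_)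
  simp only [hG]
  rw [integral_const_mul, integral_sub_right_eq_self (fun t : ℝ => Real.exp (-b * t ^ 2)) m,
    integral_gaussian, hbdef, div_div_eq_mul_div, Real.sqrt_div (by positivity),
    Real.sqrt_mul Real.pi_pos.le]
  ring
end
end

section
/- Let 0 < a < b. For every z ∈ ℂ, the function t ↦ e^{t²/b} γ_{a,z}(t) on ℝ is bounded and continuous, and the map from ℂ to the Banach space of bounded continuous ℂ-valued functions on ℝ (with the supremum norm) given by z ↦ (t ↦ e^{t²/b} γ_{a,z}(t)) is holomorphic (complex differentiable at every point of ℂ). (This expresses that γ_{a,z} ∈ 𝒜_b and that z ↦ γ_{a,z} is holomorphic into the normed space (𝒜_b, p_b).) -/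
open Complex

noncomputable section

/-- The Gaussian `γ_{a,z}(t) = (π a)^{-1/2} exp(-(t-z)²/a)`. -/
def gauss (a : ℝ) (z : ℂ) (t : ℝ) : ℂ :=
  ((Real.sqrt (Real.pi * a))⁻¹ : ℝ) * Complex.exp (-((t : ℂ) - z) ^ 2 / (a : ℂ))

/-- Completing the square. -/
lemma quad_bound (c M s : ℝ) (hc : 0 < c) : -c * s ^ 2 + M * s ≤ M ^ 2 / (4 * c) := by
  rw [le_div_iff₀ (by positivity)]
  nlinarith [sq_nonneg (2 * c * s - M)]

lemma norm_exp_bound (c : ℝ) (w : ℂ) (t : ℝ) :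
    ‖Complex.exp (-(c : ℂ) * (t : ℂ) ^ 2 + w * t)‖ ≤ Real.exp (-c * |t| ^ 2 + ‖w‖ * |t|) := by
  rw [Complex.norm_exp, Real.exp_le_exp]
  have h1 : (-(c : ℂ) * (t : ℂ) ^ 2).re = -c * |t| ^ 2 := by
    rw [sq_abs]
    have : (-(c : ℂ) * (t : ℂ) ^ 2) = ((-c * t ^ 2 : ℝ) : ℂ) := by push_cast; ring
    rw [this, Complex.ofReal_re]
  have h2 : (w * t).re ≤ ‖w‖ * |t| := by
    refine (Complex.re_le_norm _).trans ?_
    rw [norm_mul, Complex.norm_real, Real.norm_eq_abs]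
  rw [Complex.add_re, h1]
  linarith

lemma bound0 (c : ℝ) (hc : 0 < c) (w : ℂ) (t : ℝ) :
    ‖Complex.exp (-(c : ℂ) * (t : ℂ) ^ 2 + w * t)‖ ≤ Real.exp (‖w‖ ^ 2 / (4 * c)) :=
  (norm_exp_bound c w t).trans (Real.exp_le_exp.2 (quad_bound c _ _ hc))

lemma bound1 (c : ℝ) (hc : 0 < c) (w : ℂ) (t : ℝ) :
    ‖(t : ℂ) * Complex.exp (-(c : ℂ) * (t : ℂ) ^ 2 + w * t)‖ ≤
      Real.exp ((‖w‖ + 1) ^ 2 / (4 * c)) := by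
  rw [norm_mul, Complex.norm_real, Real.norm_eq_abs]
  have h1 : |t| ≤ Real.exp |t| := by linarith [Real.add_one_le_exp |t|]
  calc |t| * _ ≤ Real.exp |t| * Real.exp (-c * |t| ^ 2 + ‖w‖ * |t|) :=
        mul_le_mul h1 (norm_exp_bound c w t) (norm_nonneg _) (Real.exp_pos _).le
    _ = Real.exp (-c * |t| ^ 2 + (‖w‖ + 1) * |t|) := by rw [← Real.exp_add]; ring_nf
    _ ≤ _ := Real.exp_le_exp.2 (quad_bound c _ _ hc)

/-- The bounded continuous function `t ↦ exp (-c t² + w t)`. -/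
def hfun (c : ℝ) (hc : 0 < c) (w : ℂ) : BoundedContinuousFunction ℝ ℂ :=
  BoundedContinuousFunction.ofNormedAddCommGroup
    (fun t : ℝ => Complex.exp (-(c : ℂ) * (t : ℂ) ^ 2 + w * t)) (by fun_prop) _ (bound0 c hc w)

/-- The bounded continuous function `t ↦ t exp (-c t² + w t)`. -/
def hfun' (c : ℝ) (hc : 0 < c) (w : ℂ) : BoundedContinuousFunction ℝ ℂ :=
  BoundedContinuousFunction.ofNormedAddCommGroup
    (fun t : ℝ => (t : ℂ) * Complex.exp (-(c : ℂ) * (t : ℂ) ^ 2 + w * t)) (by fun_prop) _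
    (bound1 c hc w)

lemma hfun_deriv (c : ℝ) (hc : 0 < c) (w : ℂ) : HasDerivAt (hfun c hc) (hfun' c hc w) w := by
  rw [hasDerivAt_iff_isLittleO_nhds_zero]
  have hO : (fun k : ℂ => hfun c hc (w + k) - hfun c hc w - k • hfun' c hc w)
      =O[nhds 0] (fun k : ℂ => k ^ 2) := by
    refine Asymptotics.IsBigO.of_bound (Real.exp ((‖w‖ + 3) ^ 2 / (4 * c))) ?_
    filter_upwards [Metric.ball_mem_nhds (0 : ℂ) one_pos] with k hk
    have hk1 : ‖k‖ ≤ 1 := by simpa using (le_of_lt (by simpa using hk : ‖k‖ < 1))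
    rw [BoundedContinuousFunction.norm_le (by positivity)]
    intro t
    have e : (hfun c hc (w + k) - hfun c hc w - k • hfun' c hc w) t
        = (Complex.exp (k * t) - ∑ m ∈ Finset.range 2, (k * t) ^ m / (m.factorial : ℂ)) *
          Complex.exp (-(c : ℂ) * (t : ℂ) ^ 2 + w * t) := by
      have : Complex.exp (-(c : ℂ) * (t : ℂ) ^ 2 + (w + k) * t)
          = Complex.exp (k * t) * Complex.exp (-(c : ℂ) * (t : ℂ) ^ 2 + w * t) := by
        rw [← Complex.exp_add]; ring_nf
      simp only [hfun, hfun', BoundedContinuousFunction.coe_sub, Pi.sub_apply,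
        BoundedContinuousFunction.coe_smul, BoundedContinuousFunction.coe_ofNormedAddCommGroup,
        smul_eq_mul, this, Finset.sum_range_succ, Finset.sum_range_zero]
      simp
      ring
    rw [e, norm_mul]
    have h1 := Complex.norm_exp_sub_sum_le_norm_mul_exp (k * t) 2
    have hkt : ‖k * (t : ℂ)‖ = ‖k‖ * |t| := by
      rw [norm_mul, Complex.norm_real, Real.norm_eq_abs]
    rw [hkt] at h1
    have h2 : |t| ≤ Real.exp |t| := by linarith [Real.add_one_le_exp |t|]
    have h3 : Real.exp (‖k‖ * |t|) ≤ Real.exp |t| :=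
      Real.exp_le_exp.2 (mul_le_of_le_one_left (abs_nonneg t) hk1)
    calc _ ≤ ((‖k‖ * |t|) ^ 2 * Real.exp (‖k‖ * |t|)) *
          Real.exp (-c * |t| ^ 2 + ‖w‖ * |t|) :=
          mul_le_mul h1 (norm_exp_bound c w t) (norm_nonneg _) (by positivity)
      _ ≤ ((‖k‖ * Real.exp |t|) ^ 2 * Real.exp |t|) *
          Real.exp (-c * |t| ^ 2 + ‖w‖ * |t|) := by gcongr
      _ = Real.exp (-c * |t| ^ 2 + (‖w‖ + 3) * |t|) * ‖k ^ 2‖ := by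
          have : -c * |t| ^ 2 + (‖w‖ + 3) * |t|
            = |t| + |t| + |t| + (-c * |t| ^ 2 + ‖w‖ * |t|) := by ring
          rw [this, Real.exp_add (|t| + |t| + |t|), Real.exp_add (|t| + |t|), Real.exp_add |t| |t|,
            norm_pow]
          ring
      _ ≤ _ := by
          gcongr
          exact quad_bound c _ _ hc
  refine hO.trans_isLittleO ?_
  simpa using Asymptotics.isLittleO_pow_id (𝕜 := ℂ) (n := 2) one_lt_two

theorem stmt5 (a b : ℝ) (ha : 0 < a) (hab : a < b) :
    ∃ g : ℂ → BoundedContinuousFunction ℝ ℂ,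
      (∀ z : ℂ, ∀ t : ℝ, g z t = Real.exp (t ^ 2 / b) * gauss a z t) ∧
      Differentiable ℂ g := by
  have hb : 0 < b := ha.trans hab
  have hc : 0 < 1 / a - 1 / b := sub_pos.2 (one_div_lt_one_div_of_lt ha hab)
  refine ⟨fun z => ((((Real.sqrt (Real.pi * a))⁻¹ : ℝ) : ℂ) * Complex.exp (-z ^ 2 / a)) •
    hfun (1 / a - 1 / b) hc (2 / a * z), ?_, ?_⟩
  · intro z t
    have ha' : (a : ℂ) ≠ 0 := by exact_mod_cast ha.ne'
    have hb' : (b : ℂ) ≠ 0 := by exact_mod_cast hb.ne'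
    simp only [hfun, BoundedContinuousFunction.coe_smul,
      BoundedContinuousFunction.coe_ofNormedAddCommGroup, smul_eq_mul, gauss]
    rw [mul_assoc, ← Complex.exp_add, Complex.ofReal_exp, mul_left_comm, ← Complex.exp_add]
    congr 2
    push_cast
    field_simp
    ring
  · have hd : Differentiable ℂ (hfun (1 / a - 1 / b) hc) :=
      fun w => (hfun_deriv _ hc w).differentiableAt
    have h1 : Differentiable ℂ (fun z : ℂ => hfun (1 / a - 1 / b) hc (2 / a * z)) :=
      hd.comp (by fun_prop)
    have h2 : Differentiable ℂ (fun z : ℂ =>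
        (((Real.sqrt (Real.pi * a))⁻¹ : ℝ) : ℂ) * Complex.exp (-z ^ 2 / a)) := by fun_prop
    exact h2.smul h1
end
end

section
/- Let ρ > π/2 and let f : ℂ → ℂ be continuous on the closed strip {z ∈ ℂ : |Im z| ≤ ρ} and holomorphic on the open strip {z ∈ ℂ : |Im z| < ρ}. If there exist ε > 0 and M ≥ 0 such that |exp(ε·e^{Re z}) · f(z)| ≤ M for all z with |Im z| ≤ ρ, then f(z) = 0 for all z with |Im z| ≤ ρ. -/
open Complex

noncomputable section

open Filter Set Topology in
theorem strip_aux (ρ : ℝ) (hρ : Real.pi / 2 < ρ) (f : ℂ → ℂ)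
    (hcont : ContinuousOn f {z : ℂ | |z.im| ≤ ρ})
    (hhol : DifferentiableOn ℂ f {z : ℂ | |z.im| < ρ})
    (ε M : ℝ) (hε : 0 < ε) (hM : 0 ≤ M)
    (hbd : ∀ z : ℂ, |z.im| ≤ ρ → ‖f z‖ ≤ M * Real.exp (-(ε * Real.exp z.re)))
    (n : ℝ) (hn : 0 < n) (z : ℂ) (hz : |z.im| ≤ ρ) :
    ‖f z‖ * Real.exp (n * (Real.exp (Real.pi / (2 * ρ) * z.re)
      * Real.cos (Real.pi / (2 * ρ) * z.im))) ≤ M := by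
  have hpi := Real.pi_pos
  have hρ0 : 0 < ρ := by linarith
  obtain ⟨β, hβ⟩ : ∃ β, β = Real.pi / (2 * ρ) := ⟨_, rfl⟩
  have hβ0 : 0 < β := by rw [hβ]; positivity
  have hβ1 : β < 1 := by rw [hβ, div_lt_one (by positivity)]; linarith
  have hβρ : β * ρ = Real.pi / 2 := by rw [hβ]; field_simp
  rw [← hβ]
  have hnorm : ∀ w : ℂ, ‖f w * Complex.exp ((n : ℂ) * Complex.exp ((β : ℂ) * w))‖ =
      ‖f w‖ * Real.exp (n * (Real.exp (β * w.re) * Real.cos (β * w.im))) := by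
    intro w
    rw [norm_mul, Complex.norm_exp]
    congr 2
    simp [Complex.exp_re]
  have hset : (im ⁻¹' Ioo (-ρ) ρ) = {z : ℂ | |z.im| < ρ} := by
    ext w; simp [abs_lt]
  have hclosed : closure {z : ℂ | |z.im| < ρ} ⊆ {z : ℂ | |z.im| ≤ ρ} := by
    apply closure_minimal
    · intro w hw; exact (show |w.im| < ρ from hw).le
    · exact isClosed_le (by fun_prop) continuous_const
  have hfM : ∀ w : ℂ, |w.im| ≤ ρ → ‖f w‖ ≤ M := by
    intro w hw
    refine (hbd w hw).trans ?_
    refine mul_le_of_le_one_right hM ?_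
    rw [Real.exp_le_one_iff]
    have := Real.exp_pos w.re
    have := mul_pos hε this
    linarith
  rw [← hnorm]
  have hz' := abs_le.1 hz
  refine PhragmenLindelof.horizontal_strip (a := -ρ) (b := ρ)
    (f := fun w => f w * Complex.exp ((n : ℂ) * Complex.exp ((β : ℂ) * w)))
    ?_ ?_ ?_ ?_ hz'.1 hz'.2
  · rw [hset]
    refine ⟨hhol.mul (by fun_prop), (hcont.mono hclosed).mul (by fun_prop)⟩
  · refine ⟨0, by have : 0 < ρ - -ρ := by linarith
                  positivity, 0, ?_⟩
    obtain ⟨X, hX⟩ : ∃ X : ℝ, n = ε * Real.exp ((1 - β) * X) := by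
      refine ⟨Real.log (n / ε) / (1 - β), ?_⟩
      have : (1 - β) ≠ 0 := by linarith
      rw [mul_div_cancel₀ _ this, Real.exp_log (by positivity)]
      field_simp
    refine Asymptotics.IsBigO.of_bound (M * Real.exp (n * Real.exp (β * X))) ?_
    refine Filter.Eventually.filter_mono inf_le_right ?_
    rw [Filter.eventually_principal]
    intro w hw
    rw [hset] at hw
    have hw' : |w.im| ≤ ρ := le_of_lt hw
    rw [hnorm]
    simp only [zero_mul, Real.exp_zero, norm_one, mul_one]
    refine (mul_le_mul_of_nonneg_right (hbd w hw') (Real.exp_pos _).le).trans ?_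
    rw [mul_assoc, ← Real.exp_add]
    refine mul_le_mul_of_nonneg_left (Real.exp_le_exp.2 ?_) hM
    have h1 : n * (Real.exp (β * w.re) * Real.cos (β * w.im)) ≤ n * Real.exp (β * w.re) :=
      mul_le_mul_of_nonneg_left
        (mul_le_of_le_one_right (Real.exp_pos _).le (Real.cos_le_one _)) hn.le
    rcases le_total w.re X with h | h
    · have : n * Real.exp (β * w.re) ≤ n * Real.exp (β * X) := by gcongr
      have := mul_pos hε (Real.exp_pos w.re)
      linarith
    · have h2 : n * Real.exp (β * w.re) ≤ ε * Real.exp w.re := by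
        calc n * Real.exp (β * w.re) = ε * Real.exp ((1 - β) * X) * Real.exp (β * w.re) := by
              rw [← hX]
          _ ≤ ε * Real.exp ((1 - β) * w.re) * Real.exp (β * w.re) := by
              have : 0 ≤ 1 - β := by linarith
              gcongr
          _ = ε * Real.exp w.re := by
              rw [mul_assoc, ← Real.exp_add]; congr 2; ring
      have := mul_pos hn (Real.exp_pos (β * X))
      linarith
  · intro w hw
    rw [hnorm, hw]
    have : Real.cos (β * -ρ) = 0 := by rw [mul_neg, hβρ, Real.cos_neg, Real.cos_pi_div_two]
    rw [this]
    simpa using hfM w (by rw [hw, abs_neg, abs_of_pos hρ0])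
  · intro w hw
    rw [hnorm, hw, hβρ, Real.cos_pi_div_two]
    simpa using hfM w (by rw [hw, abs_of_pos hρ0])

/-- A Phragmén–Lindelöf type vanishing theorem: a holomorphic function on a strip of
half-width `ρ > π/2` dominated by `exp(-ε e^{Re z})` vanishes identically. -/
theorem stmt17 (ρ : ℝ) (hρ : Real.pi / 2 < ρ) (f : ℂ → ℂ)
    (hcont : ContinuousOn f {z : ℂ | |z.im| ≤ ρ})
    (hhol : DifferentiableOn ℂ f {z : ℂ | |z.im| < ρ})
    (ε M : ℝ) (hε : 0 < ε) (hM : 0 ≤ M)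
    (hbd : ∀ z : ℂ, |z.im| ≤ ρ →
      ‖Complex.exp ((ε : ℂ) * Complex.exp (z.re : ℂ)) * f z‖ ≤ M) :
    ∀ z : ℂ, |z.im| ≤ ρ → f z = 0 := by
  have hpi := Real.pi_pos
  have hρ0 : 0 < ρ := by linarith
  have hbd' : ∀ z : ℂ, |z.im| ≤ ρ → ‖f z‖ ≤ M * Real.exp (-(ε * Real.exp z.re)) := by
    intro z hz
    have h := hbd z hz
    rw [norm_mul, ← Complex.ofReal_exp, ← Complex.ofReal_mul, Complex.norm_exp,
      Complex.ofReal_re] at h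
    rw [Real.exp_neg, ← div_eq_mul_inv, le_div_iff₀ (Real.exp_pos _)]
    linarith
  have hint : Set.EqOn f 0 {z : ℂ | |z.im| < ρ} := by
    intro z hz
    have hz1 : |z.im| < ρ := hz
    have hz2 := abs_lt.1 hz1
    by_contra hne
    have hfpos : 0 < ‖f z‖ := norm_pos_iff.2 hne
    have hβ0 : 0 < Real.pi / (2 * ρ) := by positivity
    have hβρ : Real.pi / (2 * ρ) * ρ = Real.pi / 2 := by field_simp
    have hcos : 0 < Real.cos (Real.pi / (2 * ρ) * z.im) := by
      apply Real.cos_pos_of_mem_Ioo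
      constructor
      · rw [← hβρ]; nlinarith
      · rw [← hβρ]; nlinarith
    have hc := mul_pos (Real.exp_pos (Real.pi / (2 * ρ) * z.re)) hcos
    have key := fun n hn => strip_aux ρ hρ f hcont hhol ε M hε hM hbd' n hn z hz1.le
    set c := Real.exp (Real.pi / (2 * ρ) * z.re) * Real.cos (Real.pi / (2 * ρ) * z.im)
    have h := key ((M / ‖f z‖ + 1) / c) (by positivity)
    rw [div_mul_cancel₀ _ hc.ne'] at h
    have h3 := Real.add_one_le_exp (M / ‖f z‖ + 1)
    have h4 := mul_le_mul_of_nonneg_left h3 hfpos.le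
    have h5 : ‖f z‖ * (M / ‖f z‖ + 1 + 1) = M + 2 * ‖f z‖ := by field_simp; ring
    linarith
  have hset : {z : ℂ | |z.im| ≤ ρ} ⊆ closure {z : ℂ | |z.im| < ρ} := by
    have e1 : {z : ℂ | |z.im| < ρ} = im ⁻¹' Set.Ioo (-ρ) ρ := by ext w; simp [abs_lt]
    rw [e1, Complex.closure_preimage_im, closure_Ioo (by linarith)]
    intro w hw
    exact abs_le.1 hw
  have := Set.EqOn.of_subset_closure hint hcont continuousOn_const
    (fun w hw => (show |w.im| < ρ from hw).le) hset
  intro z hz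
  exact this hz
end
end

section
/- Let H be a complex Hilbert space and let (A(s))_{s∈ℝ} and (B(t))_{t∈ℝ} be strongly continuous one-parameter groups of unitary operators on H (A(s+s') = A(s)A(s'), B(t+t') = B(t)B(t'), and s ↦ A(s)ξ, t ↦ B(t)ξ are continuous for each ξ ∈ H) satisfying the covariance relation B(t) A(s) B(−t) = A(e^t s) for all s, t ∈ ℝ (so that (A,B) defines a unitary representation of the connected affine group Aff(ℝ)_e of the real line). Assume that the only vector fixed by all operators A(s), s ∈ ℝ, is 0. Let ξ ∈ H be an analytic vector, i.e. the map ℝ² → H, (s,t) ↦ A(s)B(t)ξ, is real-analytic. Suppose there exist r > π/2 and a map F : {z ∈ ℂ : |Im z| ≤ r} → H which is continuous, holomorphic on {z : |Im z| < r}, satisfies F(t) = B(t)ξ for all t ∈ ℝ, and is such that for every t ∈ ℝ with |t| < r the vector F(it) is again an analytic vector. Then ξ = 0. -/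
open Complex

noncomputable section

section AffHelpers
open MeasureTheory Filter Topology

/-- Shifting the contour of integration on a horizontal strip. -/
theorem contour_shift {E : Type*} [NormedAddCommGroup E] [NormedSpace ℂ E] [CompleteSpace E]
    (f : ℂ → E) (R C : ℝ) (hR : 0 ≤ R)
    (hd : DifferentiableOn ℂ f {z | 0 ≤ z.im ∧ z.im ≤ R})
    (hb : ∀ z : ℂ, 0 ≤ z.im → z.im ≤ R → ‖f z‖ ≤ C * (1 + z.re ^ 2)⁻¹) :
    ∫ x : ℝ, f x = ∫ x : ℝ, f (x + R * I) := by
  have hint : ∀ y : ℝ, 0 ≤ y → y ≤ R → Integrable (fun x : ℝ => f (x + y * I)) := by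
    intro y hy hy'
    have hc : Continuous (fun x : ℝ => f (x + y * I)) := by
      refine hd.continuousOn.comp_continuous (by fun_prop) ?_
      intro x; simpa using ⟨hy, hy'⟩
    refine Integrable.mono' (integrable_inv_one_add_sq.const_mul C) hc.aestronglyMeasurable ?_
    refine Eventually.of_forall fun x => ?_
    have := hb (x + y * I) (by simpa using hy) (by simpa using hy')
    simpa using this
  have hvert : ∀ u : ℕ → ℝ, Tendsto (fun n => (u n) ^ 2) atTop atTop →
      Tendsto (fun n : ℕ => ∫ y : ℝ in (0:ℝ)..R, f (u n + y * I)) atTop (𝓝 0) := by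
    intro u hu
    have h1 : Tendsto (fun n : ℕ => C * (1 + (u n) ^ 2)⁻¹ * |R - 0|) atTop (𝓝 0) := by
      have : Tendsto (fun n : ℕ => (1 + (u n) ^ 2)⁻¹) atTop (𝓝 0) :=
        tendsto_inv_atTop_zero.comp (tendsto_atTop_add_const_left _ _ hu)
      simpa using (this.const_mul C).mul_const (|R - 0|)
    refine squeeze_zero_norm (fun n => ?_) h1
    refine intervalIntegral.norm_integral_le_of_norm_le_const fun y hy => ?_
    rw [Set.uIoc_of_le hR] at hy
    have := hb (u n + y * I) (by simpa using hy.1.le) (by simpa using hy.2)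
    simpa using this
  have hnat : Tendsto (fun n : ℕ => (n : ℝ)) atTop atTop := tendsto_natCast_atTop_atTop
  have hneg : Tendsto (fun n : ℕ => -(n : ℝ)) atTop atBot := tendsto_neg_atTop_atBot.comp hnat
  have hsq : Tendsto (fun n : ℕ => (n : ℝ) ^ 2) atTop atTop :=
    (tendsto_pow_atTop two_ne_zero).comp hnat
  have t1 := intervalIntegral_tendsto_integral (hint 0 le_rfl hR) hneg hnat
  have t2 := intervalIntegral_tendsto_integral (hint R hR le_rfl) hneg hnat
  have t3 := (hvert (fun n => n) hsq).const_smul I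
  have t4 := (hvert (fun n => -n) (by simpa using hsq)).const_smul I
  have key : ∀ n : ℕ, (∫ x : ℝ in -(n:ℝ)..n, f (x + (0:ℝ) * I)) -
      (∫ x : ℝ in -(n:ℝ)..n, f (x + R * I)) +
      I • (∫ y : ℝ in (0:ℝ)..R, f ((n:ℝ) + y * I)) -
      I • (∫ y : ℝ in (0:ℝ)..R, f ((-(n:ℝ) : ℝ) + y * I)) = 0 := by
    intro n
    have := Complex.integral_boundary_rect_eq_zero_of_differentiableOn f
      ((-(n:ℝ) : ℝ) : ℂ) (((n:ℝ):ℂ) + R * I) (by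
        refine hd.mono fun z hz => ?_
        rw [Complex.mem_reProdIm] at hz
        have h2 := hz.2
        simp [Set.uIcc_of_le hR] at h2
        exact h2)
    simpa using this
  have t5 := ((t1.sub t2).add t3).sub t4
  have t6 := t5.congr key
  have := tendsto_nhds_unique t6 tendsto_const_nhds
  simpa [sub_eq_zero] using this

/-- Extension of an analytic orbit map of a one-parameter group to a strip. -/
theorem strip_ext {H : Type*} [NormedAddCommGroup H] [InnerProductSpace ℂ H] [CompleteSpace H]
    (A : ℝ → (H ≃ₗᵢ[ℂ] H))
    (hA : ∀ s s' : ℝ, ∀ ξ : H, A (s + s') ξ = A s (A s' ξ)) (v : H)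
    (hv : AnalyticAt ℝ (fun s => A s v) 0) :
    ∃ ε > 0, ∃ M : ℝ, ∃ G : ℂ → H, DifferentiableOn ℂ G {z | |z.im| ≤ ε} ∧
      (∀ z : ℂ, |z.im| ≤ ε → ‖G z‖ ≤ M) ∧ ∀ s : ℝ, G s = A s v := by
  obtain ⟨p, r, hp⟩ := hv
  let q : FormalMultilinearSeries ℂ ℂ H := fun n =>
    ContinuousMultilinearMap.mkPiRing ℂ (Fin n) (p.coeff n)
  have hqn : ∀ n, ‖q n‖ = ‖p n‖ := by
    intro n
    rw [ContinuousMultilinearMap.norm_mkPiRing, FormalMultilinearSeries.norm_apply_eq_norm_coef]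
  have hrad : q.radius = p.radius := by
    unfold FormalMultilinearSeries.radius
    simp only [hqn]
  have hqpos : 0 < q.radius := by rw [hrad]; exact hp.r_pos.trans_le hp.r_le
  have hq := q.hasFPowerSeriesOnBall hqpos
  obtain ⟨ρ', hρ'0, hρ'⟩ := ENNReal.lt_iff_exists_nnreal_btwn.1 hp.r_pos
  set ρ : ℝ := NNReal.toReal ρ' with hρ
  have hρ0 : 0 < ρ := by simpa [hρ] using hρ'0
  set G0 : ℂ → H := q.sum with hG0
  have han : AnalyticOnNhd ℂ G0 (Metric.ball 0 ρ) := by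
    refine hq.analyticOnNhd.mono ?_
    intro z hz
    rw [hrad]
    refine lt_of_lt_of_le ?_ (hρ'.le.trans hp.r_le)
    simp only [Metric.mem_ball, dist_zero_right] at hz
    rw [edist_zero_right]
    rw [← ofReal_norm]
    exact (ENNReal.ofReal_lt_coe_iff (norm_nonneg _)).2 hz
  have hreal : ∀ s : ℝ, |s| < ρ → G0 s = A s v := by
    intro s hs
    have h1 := hp.sum (y := s) (by
      refine lt_of_lt_of_le ?_ hρ'.le
      rw [edist_zero_right, ← ofReal_norm]
      exact (ENNReal.ofReal_lt_coe_iff (norm_nonneg _)).2 hs)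
    rw [zero_add] at h1
    rw [h1, hG0]
    unfold FormalMultilinearSeries.sum
    congr 1
    ext n
    simp [q]
    rw [← Complex.ofReal_pow, Complex.coe_smul]
  -- group law
  have hshift : ∀ h : ℝ, ∀ z : ℂ, |h| < ρ → z ∈ Metric.ball (0:ℂ) ρ → z + h ∈ Metric.ball (0:ℂ) ρ →
      A h (G0 z) = G0 (z + h) := by
    intro h z hh hz hzh
    let U : Set ℂ := Metric.ball 0 ρ ∩ Metric.ball (-(h:ℂ)) ρ
    have hU : IsPreconnected U := ((convex_ball _ _).inter (convex_ball _ _)).isPreconnected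
    have e1 : AnalyticOnNhd ℂ (fun z => A h (G0 z)) U := fun w hw =>
      ((A h).toContinuousLinearEquiv.toContinuousLinearMap.analyticAt _).comp (han w hw.1)
    have e2 : AnalyticOnNhd ℂ (fun z => G0 (z + h)) U := fun w hw => by
      have : w + h ∈ Metric.ball (0:ℂ) ρ := by
        have := hw.2; simpa [dist_eq_norm] using this
      exact (han _ this).comp_of_eq (by fun_prop) rfl
    have h0 : (0:ℂ) ∈ U := ⟨by simpa using hρ0, by simpa [dist_eq_norm] using hh⟩
    have hfr : ∃ᶠ z : ℂ in 𝓝[≠] 0, A h (G0 z) = G0 (z + h) := by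
      have ht : Tendsto (fun x : ℝ => (x : ℂ)) (𝓝[≠] 0) (𝓝[≠] 0) := by
        refine tendsto_nhdsWithin_iff.2 ⟨?_, ?_⟩
        · have : Tendsto (fun x : ℝ => (x : ℂ)) (𝓝 0) (𝓝 ((0:ℝ):ℂ)) :=
            Complex.continuous_ofReal.tendsto 0
          exact (by simpa using this : Tendsto (fun x : ℝ => (x : ℂ)) (𝓝 0) (𝓝 0)).mono_left
            nhdsWithin_le_nhds
        · filter_upwards [self_mem_nhdsWithin] with x hx
          simpa using hx
      refine ht.frequently (Eventually.frequently ?_)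
      refine Filter.Eventually.filter_mono nhdsWithin_le_nhds ?_
      have hc1 : ∀ᶠ x : ℝ in 𝓝 0, |x| < ρ :=
        (continuous_abs.tendsto' 0 0 abs_zero).eventually_lt_const hρ0
      have hc2 : ∀ᶠ x : ℝ in 𝓝 0, |x + h| < ρ :=
        ((by fun_prop : Continuous fun x : ℝ => |x + h|).tendsto' 0 |h| (by simp)).eventually_lt_const hh
      filter_upwards [hc1, hc2] with x h1 h2
      rw [hreal x h1, ← Complex.ofReal_add, hreal _ h2, add_comm, hA]
    exact e1.eqOn_of_preconnected_of_frequently_eq e2 hU h0 hfr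
      ⟨hz, by simpa [dist_eq_norm] using hzh⟩
  let G : ℂ → H := fun z => A z.re (G0 (z.im * I))
  have hGreal : ∀ s : ℝ, G s = A s v := by
    intro s
    have := hreal 0 (by simpa using hρ0)
    simp only [Complex.ofReal_zero] at this
    simp only [G, Complex.ofReal_re, Complex.ofReal_im, Complex.ofReal_zero, zero_mul, this]
    rw [← hA, add_zero]
  have hmem : ∀ y : ℝ, |y| ≤ ρ / 2 → (y * I : ℂ) ∈ Metric.ball (0:ℂ) ρ := by
    intro y hy; simp; linarith
  have hcomp : IsCompact (Set.Icc (-(ρ/2)) (ρ/2)) := isCompact_Icc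
  obtain ⟨M, hM⟩ := hcomp.exists_bound_of_continuousOn (f := fun y : ℝ => G0 (y * I)) (by
    refine han.continuousOn.comp (by fun_prop) ?_
    intro y hy
    exact hmem y (abs_le.2 hy))
  refine ⟨ρ / 2, by positivity, M, G, ?_, ?_, hGreal⟩
  · intro z hz
    refine DifferentiableAt.differentiableWithinAt ?_
    have hz' : |z.im| ≤ ρ / 2 := hz
    have hd : DifferentiableAt ℂ (fun w => A z.re (G0 (w - z.re))) z := by
      have h1 : DifferentiableAt ℂ G0 (z - z.re) := by
        refine (han _ ?_).differentiableAt
        convert hmem z.im hz' using 1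
        apply Complex.ext <;> simp
      have h2 : DifferentiableAt ℂ (fun w => G0 (w - z.re)) z :=
        DifferentiableAt.comp (g := G0) (f := fun w : ℂ => w - z.re) z h1 (by fun_prop)
      exact (A z.re).toContinuousLinearEquiv.toContinuousLinearMap.differentiableAt.comp z h2
    refine hd.congr_of_eventuallyEq ?_
    have c1 : ∀ᶠ w : ℂ in 𝓝 z, |w.re - z.re| < ρ :=
      ((by fun_prop : Continuous fun w : ℂ => |w.re - z.re|).tendsto' z 0 (by simp)).eventually_lt_const hρ0
    have c2 : ∀ᶠ w : ℂ in 𝓝 z, |w.im| < ρ :=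
      ((by fun_prop : Continuous fun w : ℂ => |w.im|).tendsto' z _ rfl).eventually_lt_const (by linarith)
    have c3 : ∀ᶠ w : ℂ in 𝓝 z, ‖w - z.re‖ < ρ :=
      ((by fun_prop : Continuous fun w : ℂ => ‖w - z.re‖).tendsto' z _ rfl).eventually_lt_const (by
        have : z - z.re = z.im * I := by apply Complex.ext <;> simp
        rw [this]; simp; linarith)
    filter_upwards [c1, c2, c3] with w h1 h2 h3
    have e : (w.im * I : ℂ) + ((w.re - z.re : ℝ) : ℂ) = w - z.re := by
      apply Complex.ext <;> simp
    have := hshift (w.re - z.re) (w.im * I) h1 (by simpa using h2) (by rw [e]; simpa using h3)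
    rw [e] at this
    rw [← this, ← hA]
    simp [G]
  · intro z hz
    simp only [G, LinearIsometryEquiv.norm_map]
    exact hM _ (abs_le.1 hz)

/-- A Phragmen-Lindelof type uniqueness statement on a strip. -/
theorem strip_unique {E : Type*} [NormedAddCommGroup E] [NormedSpace ℂ E]
    (Φ : ℂ → E) (r M C δ : ℝ) (hr : Real.pi / 2 < r) (hδ : 0 < δ)
    (hd : DifferentiableOn ℂ Φ {z | |z.im| < r})
    (hM : ∀ z : ℂ, |z.im| ≤ Real.pi / 2 → ‖Φ z‖ ≤ M)
    (h1 : ∀ x : ℝ, ‖Φ (x + (Real.pi / 2 : ℝ) * I)‖ ≤ C * Real.exp (-δ * Real.exp x))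
    (h2 : ∀ x : ℝ, ‖Φ (x + (-(Real.pi / 2) : ℝ) * I)‖ ≤ C * Real.exp (-δ * Real.exp x)) :
    Φ 0 = 0 := by
  have hpi := Real.pi_pos
  set c : ℝ := δ / Real.pi with hc
  have hc0 : 0 < c := by positivity
  have hM0 : 0 ≤ M := (norm_nonneg _).trans (hM 0 (by simp; positivity))
  have hC0 : 0 ≤ C := by
    have := (norm_nonneg _).trans (h1 0)
    exact nonneg_of_mul_nonneg_left this (Real.exp_pos _)
  let f : ℂ → E := fun w => (w * exp (-(c * (w * log w)))) • Φ (log w)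
  have hnorm : ∀ w : ℂ, ‖f w‖ =
      ‖w‖ * Real.exp (-(c * (w.re * Real.log ‖w‖ - w.im * arg w))) * ‖Φ (log w)‖ := by
    intro w
    simp only [f, norm_smul, norm_mul, Complex.norm_exp]
    simp [Complex.log_re, Complex.log_im]
  have harg : ∀ w : ℂ, 0 ≤ w.re → |arg w| ≤ Real.pi / 2 := fun w hw =>
    Complex.abs_arg_le_pi_div_two_iff.2 hw
  have hbd : ∀ w : ℂ, 0 ≤ w.re → ‖f w‖ ≤ ‖w‖ * Real.exp (c * (1 + Real.pi / 2 * ‖w‖)) * M := by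
    intro w hw
    rw [hnorm]
    have hΦ : ‖Φ (log w)‖ ≤ M := hM _ (by rw [Complex.log_im]; exact harg w hw)
    have hl : -1 ≤ w.re * Real.log ‖w‖ := by
      rcases eq_or_ne w 0 with rfl | hw0
      · simp
      have hn : 0 < ‖w‖ := norm_pos_iff.2 hw0
      rcases le_total 0 (Real.log ‖w‖) with h | h
      · linarith [mul_nonneg hw h]
      · have h3 := Real.one_sub_inv_le_log_of_pos hn
        have h4 : ‖w‖ * (1 - ‖w‖⁻¹) ≤ ‖w‖ * Real.log ‖w‖ := by gcongr
        have h5 : ‖w‖ * (1 - ‖w‖⁻¹) = ‖w‖ - 1 := by field_simp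
        have h6 : w.re ≤ ‖w‖ := Complex.re_le_norm w
        nlinarith
    have hi : w.im * arg w ≤ Real.pi / 2 * ‖w‖ := by
      calc w.im * arg w ≤ |w.im * arg w| := le_abs_self _
        _ = |w.im| * |arg w| := abs_mul _ _
        _ ≤ ‖w‖ * (Real.pi / 2) := by
          gcongr
          · exact Complex.abs_im_le_norm w
          · exact harg w hw
        _ = _ := by ring
    gcongr
    nlinarith
  have hlogd : ∀ w : ℂ, 0 ≤ w.re → w ≠ 0 → DifferentiableAt ℂ f w := by
    intro w hw hw0
    have hs : w ∈ slitPlane := by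
      rw [Complex.mem_slitPlane_iff]
      by_contra! h
      exact hw0 (Complex.ext (le_antisymm h.1 hw) h.2)
    have hl : DifferentiableAt ℂ log w := Complex.differentiableAt_log hs
    have ho : IsOpen {z : ℂ | |z.im| < r} := isOpen_lt (by fun_prop) (by fun_prop)
    have hΦ : DifferentiableAt ℂ Φ (log w) := by
      refine hd.differentiableAt (ho.mem_nhds ?_)
      change |(log w).im| < r
      rw [Complex.log_im]
      exact (harg w hw).trans_lt hr
    have hcomp : DifferentiableAt ℂ (fun w => Φ (log w)) w := DifferentiableAt.comp w hΦ hl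
    have : DifferentiableAt ℂ (fun w => (w * exp (-(c * (w * log w))))) w := by fun_prop
    exact this.smul hcomp
  have hdc : DiffContOnCl ℂ f {z | 0 < z.re} := by
    refine ⟨fun w hw => (hlogd w hw.le (by rintro rfl; simp at hw)).differentiableWithinAt, ?_⟩
    have hcl : closure {z : ℂ | 0 < z.re} = {z | 0 ≤ z.re} := Complex.closure_setOfPred_lt_re 0
    rw [hcl]
    intro w hw
    rcases eq_or_ne w 0 with rfl | hw0
    · have hf0 : f 0 = 0 := by simp [f]
      rw [ContinuousWithinAt, hf0]
      have ht : Tendsto (fun w : ℂ => ‖w‖ * Real.exp (c * (1 + Real.pi / 2 * ‖w‖)) * M)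
          (𝓝[{z | 0 ≤ z.re}] 0) (𝓝 0) :=
        ((by fun_prop : Continuous fun w : ℂ =>
          ‖w‖ * Real.exp (c * (1 + Real.pi / 2 * ‖w‖)) * M).tendsto' 0 0 (by simp)).mono_left
            nhdsWithin_le_nhds
      refine squeeze_zero_norm' ?_ ht
      filter_upwards [self_mem_nhdsWithin] with w hw
      exact hbd w hw
    · exact (hlogd w hw hw0).continuousAt.continuousWithinAt
  have hz := PhragmenLindelof.eq_zero_on_right_half_plane_of_superexponential_decay hdc ?_ ?_ ?_
  · have := hz (show (1:ℂ) ∈ {z : ℂ | 0 ≤ z.re} by simp)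
    simpa [f] using this
  · refine ⟨1, by norm_num, 1 + c * (Real.pi / 2), ?_⟩
    refine Asymptotics.IsBigO.of_bound (Real.exp c * M) ?_
    refine (eventually_inf_principal.2 (Eventually.of_forall fun w hw => ?_))
    have hw' : 0 ≤ w.re := le_of_lt hw
    refine (hbd w hw').trans ?_
    have : ‖w‖ ≤ Real.exp ‖w‖ := by linarith [Real.add_one_le_exp ‖w‖]
    rw [Real.norm_of_nonneg (Real.exp_pos _).le, Real.rpow_one]
    calc ‖w‖ * Real.exp (c * (1 + Real.pi / 2 * ‖w‖)) * M
        ≤ Real.exp ‖w‖ * Real.exp (c * (1 + Real.pi / 2 * ‖w‖)) * M := by gcongr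
      _ = Real.exp c * M * Real.exp ((1 + c * (Real.pi / 2)) * ‖w‖) := by
        rw [← Real.exp_add]
        rw [mul_comm (Real.exp c) M, mul_assoc M, ← Real.exp_add, mul_comm M]
        congr 2; ring
  · intro n
    have ht : Tendsto (fun x : ℝ => M * Real.exp (-x)) atTop (𝓝 0) := by
      simpa using Real.tendsto_exp_neg_atTop_nhds_zero.const_mul M
    refine squeeze_zero' (Eventually.of_forall fun x => by positivity) ?_ ht
    have hl : ∀ᶠ x : ℝ in atTop, n + 2 ≤ c * Real.log x :=
      (Real.tendsto_log_atTop.const_mul_atTop hc0).eventually_ge_atTop _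
    filter_upwards [hl, eventually_gt_atTop 0] with x hx hx0
    rw [hnorm]
    have hΦ : ‖Φ (log x)‖ ≤ M := hM _ (by
      rw [Complex.log_im]; exact harg x (by simpa using hx0.le))
    have : x ≤ Real.exp x := by linarith [Real.add_one_le_exp x]
    simp only [Complex.norm_real, Complex.ofReal_re, Complex.ofReal_im, zero_mul, sub_zero,
      Real.norm_eq_abs, abs_of_pos hx0]
    calc Real.exp x ^ n * (x * Real.exp (-(c * (x * Real.log x))) * ‖Φ (log x)‖)
        ≤ Real.exp x ^ n * (Real.exp x * Real.exp (-(c * (x * Real.log x))) * M) := by gcongr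
      _ = M * Real.exp (n * x + x - c * (x * Real.log x)) := by
        rw [← Real.exp_nat_mul, sub_eq_add_neg, Real.exp_add, Real.exp_add]; ring
      _ ≤ M * Real.exp (-x) := by
        gcongr
        nlinarith
  · refine ⟨C * (2 / δ), fun y => ?_⟩
    have hmain : ∀ t : ℝ, 0 < t →
        t * Real.exp (c * (t * (Real.pi / 2))) * (C * Real.exp (-δ * t)) ≤ C * (2 / δ) := by
      intro t ht
      have e1 : c * (t * (Real.pi / 2)) = δ * t / 2 := by rw [hc]; field_simp
      have e2 : Real.exp (-δ * t) = Real.exp (-(δ * t / 2)) * Real.exp (-(δ * t / 2)) := by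
        rw [← Real.exp_add]; congr 1; ring
      have e3 : Real.exp (δ * t / 2) * Real.exp (-(δ * t / 2)) = 1 := by
        rw [← Real.exp_add]; simp
      have e4 : δ * t / 2 * Real.exp (-(δ * t / 2)) ≤ 1 := by
        rw [← e3]; gcongr; linarith [Real.add_one_le_exp (δ * t / 2)]
      calc t * Real.exp (c * (t * (Real.pi / 2))) * (C * Real.exp (-δ * t))
          = C * (2 / δ) * (δ * t / 2 * Real.exp (-(δ * t / 2))) *
            (Real.exp (δ * t / 2) * Real.exp (-(δ * t / 2))) := by
              rw [e1, e2]; field_simp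
        _ ≤ C * (2 / δ) * 1 * 1 := by rw [e3]; gcongr
        _ = _ := by ring
    rcases lt_trichotomy y 0 with hy | rfl | hy
    · have ha : arg (y * I) = -(Real.pi / 2) := by
        have := Complex.arg_real_mul (-I) (neg_pos.2 hy)
        rw [Complex.arg_neg_I] at this
        rw [← this]; simp
      have hlog : log (y * I) = (Real.log (-y) : ℝ) + (-(Real.pi / 2) : ℝ) * I := by
        apply Complex.ext
        · simp [Complex.log_re, abs_of_neg hy]
        · rw [Complex.log_im, ha]; simp
      rw [hnorm, ha, hlog]
      have := h2 (Real.log (-y))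
      rw [Real.exp_log (neg_pos.2 hy)] at this
      refine le_trans ?_ (hmain (-y) (neg_pos.2 hy))
      simp only [norm_mul, Complex.norm_real, Complex.norm_I, mul_one, Real.norm_eq_abs,
        abs_of_neg hy]
      have e : -(c * ((y * I : ℂ).re * Real.log (-y) - (y * I : ℂ).im * -(Real.pi / 2))) =
        c * (-y * (Real.pi / 2)) := by simp
      rw [e]
      exact mul_le_mul_of_nonneg_left this (mul_nonneg (by linarith) (Real.exp_pos _).le)
    · simp [f]; positivity
    · have ha : arg (y * I) = (Real.pi / 2) := by
        have := Complex.arg_real_mul (I) hy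
        rw [Complex.arg_I] at this
        exact this
      have hlog : log (y * I) = (Real.log y : ℝ) + (Real.pi / 2 : ℝ) * I := by
        apply Complex.ext
        · simp [Complex.log_re, abs_of_pos hy]
        · rw [Complex.log_im, ha]; simp
      rw [hnorm, ha, hlog]
      have := h1 (Real.log y)
      rw [Real.exp_log hy] at this
      refine le_trans ?_ (hmain y hy)
      simp only [norm_mul, Complex.norm_real, Complex.norm_I, mul_one, Real.norm_eq_abs,
        abs_of_pos hy]
      have e : -(c * ((y * I : ℂ).re * Real.log y - (y * I : ℂ).im * (Real.pi / 2))) =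
        c * (y * (Real.pi / 2)) := by simp
      rw [e]
      gcongr

/-- The kernel used for smoothing. -/
def kerAff (a l : ℝ) (z : ℂ) : ℂ := exp (a * z * I) * ((z + l * I) ^ 2)⁻¹

theorem kerAff_bound (a l : ℝ) (hl : 0 < l) (z : ℂ) (hz : 0 ≤ z.im) :
    ‖kerAff a l z‖ ≤ Real.exp (-(a * z.im)) * ((1 + (l ^ 2)⁻¹) * (1 + z.re ^ 2)⁻¹) := by
  unfold kerAff
  rw [norm_mul, Complex.norm_exp, norm_inv, norm_pow, ← Complex.normSq_eq_norm_sq,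
    Complex.normSq_apply]
  have e : ((a : ℂ) * z * I).re = -(a * z.im) := by simp
  rw [e]
  gcongr
  simp only [Complex.add_re, Complex.add_im, Complex.mul_re, Complex.mul_im, Complex.ofReal_re,
    Complex.ofReal_im, Complex.I_re, Complex.I_im, mul_zero, mul_one, zero_mul, sub_zero, add_zero,
    zero_sub, neg_zero]
  have h1 : 0 < z.re * z.re + (z.im + l) * (z.im + l) := by nlinarith [mul_self_nonneg z.re]
  rw [← div_eq_mul_inv, inv_eq_one_div, div_le_div_iff₀ h1 (by positivity)]
  have h2 : z.re ^ 2 + l ^ 2 ≤ z.re * z.re + (z.im + l) * (z.im + l) := by nlinarith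
  have h3 : 1 * (1 + z.re ^ 2) ≤ (1 + (l ^ 2)⁻¹) * (z.re ^ 2 + l ^ 2) := by
    have : (1 + (l ^ 2)⁻¹) * (z.re ^ 2 + l ^ 2) = z.re ^ 2 + l ^ 2 + (l^2)⁻¹ * z.re ^ 2 + 1 := by
      field_simp; ring
    rw [this]
    have : 0 ≤ (l^2)⁻¹ * z.re ^ 2 := by positivity
    nlinarith
  refine h3.trans ?_
  gcongr

theorem kerAff_bound_real (a l : ℝ) (hl : 0 < l) (s : ℝ) :
    ‖kerAff a l s‖ ≤ (1 + (l ^ 2)⁻¹) * (1 + s ^ 2)⁻¹ := by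
  simpa using kerAff_bound a l hl s (by simp)

theorem kerAff_ne (l : ℝ) (hl : 0 < l) (z : ℂ) (hz : 0 ≤ z.im) : (z + l * I) ^ 2 ≠ 0 := by
  apply pow_ne_zero
  intro h
  have := congrArg Complex.im h
  simp at this
  linarith

theorem kerAff_diff (a l : ℝ) (hl : 0 < l) (z : ℂ) (hz : 0 ≤ z.im) :
    DifferentiableAt ℂ (kerAff a l) z := by
  unfold kerAff
  have := kerAff_ne l hl z hz
  fun_prop (disch := assumption)

theorem kerAff_cont (a l : ℝ) (hl : 0 < l) : Continuous fun s : ℝ => kerAff a l s := by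
  rw [continuous_iff_continuousAt]
  intro s
  exact ContinuousAt.comp (g := kerAff a l) (f := fun s : ℝ => (s : ℂ))
    (kerAff_diff a l hl s (by simp)).continuousAt
    Complex.continuous_ofReal.continuousAt

section
variable {H : Type*} [NormedAddCommGroup H] [InnerProductSpace ℂ H]

theorem grp_zero (A : ℝ → (H ≃ₗᵢ[ℂ] H))
    (hA : ∀ s s' : ℝ, ∀ ξ : H, A (s + s') ξ = A s (A s' ξ)) (v : H) : A 0 v = v := by
  apply (A 0).injective
  rw [← hA, add_zero]

theorem orbit_integrable (A : ℝ → (H ≃ₗᵢ[ℂ] H)) (hAc : ∀ ξ : H, Continuous fun s : ℝ => A s ξ)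
    (a l : ℝ) (hl : 0 < l) (v : H) : Integrable (fun s : ℝ => kerAff a l s • A s v) := by
  refine Integrable.mono' ((integrable_inv_one_add_sq.const_mul (1 + (l ^ 2)⁻¹)).mul_const ‖v‖)
    ((kerAff_cont a l hl).smul (hAc v)).aestronglyMeasurable ?_
  refine Eventually.of_forall fun s => ?_
  rw [norm_smul, LinearIsometryEquiv.norm_map]
  gcongr
  exact kerAff_bound_real a l hl s

theorem exists_op (A : ℝ → (H ≃ₗᵢ[ℂ] H)) (hAc : ∀ ξ : H, Continuous fun s : ℝ => A s ξ)
    (a l : ℝ) (hl : 0 < l) :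
    ∃ K : H →L[ℂ] H, ∀ v, K v = ∫ s : ℝ, kerAff a l s • A s v := by
  let L : H →ₗ[ℂ] H :=
    { toFun := fun v => ∫ s : ℝ, kerAff a l s • A s v
      map_add' := fun v w => by
        rw [← integral_add (orbit_integrable A hAc a l hl v) (orbit_integrable A hAc a l hl w)]
        simp only [map_add, smul_add]
      map_smul' := fun c v => by
        simp only [map_smul, RingHom.id_apply]
        rw [← integral_smul]
        congr 1; ext s; rw [smul_comm] }
  refine ⟨L.mkContinuous (∫ s : ℝ, (1 + (l ^ 2)⁻¹) * (1 + s ^ 2)⁻¹) ?_, fun v => rfl⟩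
  intro v
  rw [← integral_mul_const]
  refine norm_integral_le_of_norm_le
    ((integrable_inv_one_add_sq.const_mul (1 + (l ^ 2)⁻¹)).mul_const ‖v‖) ?_
  refine Eventually.of_forall fun s => ?_
  rw [norm_smul, LinearIsometryEquiv.norm_map]
  gcongr
  exact kerAff_bound_real a l hl s

variable [CompleteSpace H]

theorem smooth_decay (A B : ℝ → (H ≃ₗᵢ[ℂ] H))
    (hA : ∀ s s' : ℝ, ∀ ξ : H, A (s + s') ξ = A s (A s' ξ))
    (hB : ∀ t t' : ℝ, ∀ ξ : H, B (t + t') ξ = B t (B t' ξ))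
    (hcov : ∀ s t : ℝ, ∀ ξ : H, B t (A s (B (-t) ξ)) = A (Real.exp t * s) ξ)
    (a l : ℝ) (ha : 0 < a) (hl : 0 < l) (v : H) (hv : AnalyticAt ℝ (fun s => A s v) 0) :
    ∃ C : ℝ, ∃ δ > 0, 0 ≤ C ∧ ∀ x : ℝ,
      ‖∫ s : ℝ, kerAff a l s • A s (B x v)‖ ≤ C * Real.exp (-δ * Real.exp x) := by
  obtain ⟨ε, hε, M, G, hGd, hGM, hGr⟩ := strip_ext A hA v hv
  have hM0 : 0 ≤ M := (norm_nonneg _).trans (hGM 0 (by simpa using hε.le))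
  set D : ℝ := 1 + (l ^ 2)⁻¹ with hD
  have hD0 : 0 ≤ D := by positivity
  refine ⟨∫ s : ℝ, (D * (1 + s ^ 2)⁻¹) * M, a * ε, by positivity,
    integral_nonneg fun s => by positivity, fun x => ?_⟩
  set R : ℝ := Real.exp x * ε with hR
  have hR0 : 0 ≤ R := by positivity
  let G' : ℂ → H := fun z => B x (G ((Real.exp (-x) : ℝ) * z))
  have him : ∀ z : ℂ, |z.im| ≤ R → |(((Real.exp (-x) : ℝ) : ℂ) * z).im| ≤ ε := by
    intro z hz
    rw [Complex.im_ofReal_mul, abs_mul, abs_of_pos (Real.exp_pos _)]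
    calc Real.exp (-x) * |z.im| ≤ Real.exp (-x) * R := by gcongr
      _ = ε := by rw [hR, ← mul_assoc, ← Real.exp_add]; simp
  have hG'r : ∀ s : ℝ, G' s = A s (B x v) := by
    intro s
    simp only [G']
    rw [← Complex.ofReal_mul, hGr, ← hcov, neg_neg, ← hB, add_neg_cancel, grp_zero B hB]
  have hshift := contour_shift (fun z => kerAff a l z • G' z) R (D * M) hR0 ?_ ?_
  · have e1 : (∫ s : ℝ, kerAff a l s • A s (B x v)) = ∫ s : ℝ, kerAff a l s • G' s := by
      simp only [hG'r]
    rw [e1, hshift, ← integral_mul_const]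
    refine norm_integral_le_of_norm_le
      (((integrable_inv_one_add_sq.const_mul D).mul_const M).mul_const _) ?_
    refine Eventually.of_forall fun s => ?_
    rw [norm_smul]
    have h1 := kerAff_bound a l hl (s + R * I) (by simpa using hR0)
    have h2 : ‖G' (s + R * I)‖ ≤ M := by
      simp only [G', LinearIsometryEquiv.norm_map]
      exact hGM _ (him _ (by simp [abs_of_nonneg hR0]))
    simp only [Complex.add_re, Complex.add_im, Complex.mul_re, Complex.mul_im, Complex.ofReal_re,
      Complex.ofReal_im, Complex.I_re, Complex.I_im, mul_zero, mul_one, zero_mul, sub_zero,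
      add_zero, zero_add] at h1
    calc _ ≤ Real.exp (-(a * R)) * (D * (1 + s ^ 2)⁻¹) * M := by gcongr
      _ = _ := by rw [hR]; rw [show -(a * (Real.exp x * ε)) = -(a * ε) * Real.exp x by ring]; ring
  · intro z hz
    have hz' : |z.im| ≤ R := abs_le.2 ⟨by linarith [hz.1], hz.2⟩
    refine (kerAff_diff a l hl z hz.1).differentiableWithinAt.smul ?_
    have h1 : DifferentiableWithinAt ℂ (fun z : ℂ => G ((Real.exp (-x) : ℝ) * z))
        {z | 0 ≤ z.im ∧ z.im ≤ R} z := by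
      refine DifferentiableWithinAt.comp (g := G) (t := {z | |z.im| ≤ ε}) z (hGd _ (him z hz'))
        (by fun_prop) ?_
      intro w hw
      exact him w (abs_le.2 ⟨by linarith [hw.1], hw.2⟩)
    exact (B x).toContinuousLinearEquiv.toContinuousLinearMap.differentiableAt.comp_differentiableWithinAt z h1
  · intro z hz0 hzR
    have h1 := kerAff_bound a l hl z hz0
    have h2 : ‖G' z‖ ≤ M := by
      simp only [G', LinearIsometryEquiv.norm_map]
      exact hGM _ (him _ (abs_le.2 ⟨by linarith, hzR⟩))
    have h3 : Real.exp (-(a * z.im)) ≤ 1 := Real.exp_le_one_iff.2 (by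
      have := mul_nonneg ha.le hz0; linarith)
    rw [norm_smul]
    calc _ ≤ 1 * (D * (1 + z.re ^ 2)⁻¹) * M := by
          gcongr
          exact h1.trans (by gcongr)
      _ = _ := by ring

theorem F_translate (B : ℝ → (H ≃ₗᵢ[ℂ] H))
    (hB : ∀ t t' : ℝ, ∀ ξ : H, B (t + t') ξ = B t (B t' ξ)) (ξ : H)
    (r : ℝ) (hr : 0 < r) (F : ℂ → H)
    (hFh : DifferentiableOn ℂ F {z : ℂ | |z.im| < r})
    (hFt : ∀ t : ℝ, F (t : ℂ) = B t ξ) (t : ℝ) (z : ℂ) (hz : |z.im| < r) :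
    F (z + t) = B t (F z) := by
  let U : Set ℂ := {z : ℂ | |z.im| < r}
  have ho : IsOpen U := isOpen_lt (by fun_prop) (by fun_prop)
  have hUc : Convex ℝ U := by
    have : U = Complex.imLm ⁻¹' (Set.Ioo (-r) r) := by
      ext z; simp [U, abs_lt]
    rw [this]
    exact (convex_Ioo _ _).linear_preimage _
  have e1 : AnalyticOnNhd ℂ (fun z => F (z + t)) U := by
    refine DifferentiableOn.analyticOnNhd ?_ ho
    refine hFh.comp (by fun_prop) ?_
    intro w hw
    simpa [U] using hw
  have e2 : AnalyticOnNhd ℂ (fun z => B t (F z)) U := by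
    refine DifferentiableOn.analyticOnNhd ?_ ho
    exact (B t).toContinuousLinearEquiv.toContinuousLinearMap.differentiable.comp_differentiableOn hFh
  have hfr : ∃ᶠ z : ℂ in 𝓝[≠] 0, F (z + t) = B t (F z) := by
    have ht : Tendsto (fun x : ℝ => (x : ℂ)) (𝓝[≠] 0) (𝓝[≠] 0) := by
      refine tendsto_nhdsWithin_iff.2 ⟨?_, ?_⟩
      · have : Tendsto (fun x : ℝ => (x : ℂ)) (𝓝 0) (𝓝 ((0:ℝ):ℂ)) :=
          Complex.continuous_ofReal.tendsto 0
        exact (by simpa using this : Tendsto (fun x : ℝ => (x : ℂ)) (𝓝 0) (𝓝 0)).mono_left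
          nhdsWithin_le_nhds
      · filter_upwards [self_mem_nhdsWithin] with x hx
        simpa using hx
    refine ht.frequently (Eventually.frequently (Eventually.of_forall fun x => ?_))
    rw [← Complex.ofReal_add, hFt, hFt, add_comm, hB]
  exact e1.eqOn_of_preconnected_of_frequently_eq e2 hUc.isPreconnected
    (show (0:ℂ) ∈ U by simpa [U] using hr) hfr hz

theorem smooth_vanish (A B : ℝ → (H ≃ₗᵢ[ℂ] H))
    (hA : ∀ s s' : ℝ, ∀ ξ : H, A (s + s') ξ = A s (A s' ξ))
    (hB : ∀ t t' : ℝ, ∀ ξ : H, B (t + t') ξ = B t (B t' ξ))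
    (hAc : ∀ ξ : H, Continuous fun s : ℝ => A s ξ)
    (hcov : ∀ s t : ℝ, ∀ ξ : H, B t (A s (B (-t) ξ)) = A (Real.exp t * s) ξ)
    (ξ : H) (r : ℝ) (hr : Real.pi / 2 < r) (F : ℂ → H)
    (hFh : DifferentiableOn ℂ F {z : ℂ | |z.im| < r})
    (hFt : ∀ t : ℝ, F (t : ℂ) = B t ξ)
    (hFan : ∀ t : ℝ, |t| < r → AnalyticAt ℝ (fun s => A s (F ((t : ℂ) * Complex.I))) 0)
    (a l : ℝ) (ha : 0 < a) (hl : 0 < l) :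
    ∫ s : ℝ, kerAff a l s • A s ξ = 0 := by
  have hpi := Real.pi_pos
  obtain ⟨K, hK⟩ := exists_op A hAc a l hl
  have hF := F_translate B hB ξ r (by linarith) F hFh hFt
  have hF' : ∀ x y : ℝ, |y| < r → F (x + y * I) = B x (F (y * I)) := by
    intro x y hy
    rw [← hF x (y * I) (by simpa using hy), add_comm]
  obtain ⟨C1, δ1, hδ1, hC1, hd1⟩ := smooth_decay A B hA hB hcov a l ha hl _
    (hFan (Real.pi / 2) (by rw [abs_of_pos (by positivity)]; exact hr))
  obtain ⟨C2, δ2, hδ2, hC2, hd2⟩ := smooth_decay A B hA hB hcov a l ha hl _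
    (hFan (-(Real.pi / 2)) (by rw [abs_neg, abs_of_pos (by positivity)]; exact hr))
  obtain ⟨M, hM⟩ := (isCompact_Icc (a := -(Real.pi/2)) (b := Real.pi/2)).exists_bound_of_continuousOn
    (f := fun y : ℝ => F (y * I)) (by
      refine hFh.continuousOn.comp (by fun_prop) ?_
      intro y hy
      have := abs_le.2 hy
      simpa using this.trans_lt hr)
  have key := strip_unique (fun z => K (F z)) r (‖K‖ * M) (max C1 C2) (min δ1 δ2) hr
    (lt_min hδ1 hδ2) (K.differentiable.comp_differentiableOn hFh) ?_ ?_ ?_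
  · have h0 := hFt 0
    rw [grp_zero B hB, Complex.ofReal_zero] at h0
    rw [← hK, ← h0]; exact key
  · intro z hz
    refine (K.le_opNorm _).trans ?_
    gcongr
    have := hF' z.re z.im (hz.trans_lt hr)
    rw [Complex.re_add_im] at this
    rw [this, LinearIsometryEquiv.norm_map]
    exact hM _ (abs_le.1 hz)
  · intro x
    rw [hF' x _ (by rw [abs_of_pos (by positivity)]; exact hr), hK]
    refine (hd1 x).trans ?_
    gcongr
    · exact le_max_left _ _
    · exact min_le_left _ _
  · intro x
    rw [hF' x _ (by rw [abs_neg, abs_of_pos (by positivity)]; exact hr), hK]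
    refine (hd2 x).trans ?_
    gcongr
    · exact le_max_right _ _
    · exact min_le_right _ _


theorem smooth_vanish_zero (A : ℝ → (H ≃ₗᵢ[ℂ] H)) (hAc : ∀ ξ : H, Continuous fun s : ℝ => A s ξ)
    (ξ : H) (l : ℝ) (hl : 0 < l)
    (h : ∀ a : ℝ, 0 < a → ∫ s : ℝ, kerAff a l s • A s ξ = 0) :
    ∫ s : ℝ, kerAff 0 l s • A s ξ = 0 := by
  have ht : Tendsto (fun n : ℕ => ∫ s : ℝ, kerAff (1 / ((n : ℝ) + 1)) l s • A s ξ) atTop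
      (𝓝 (∫ s : ℝ, kerAff 0 l s • A s ξ)) := by
    refine tendsto_integral_of_dominated_convergence
      (fun s => (1 + (l ^ 2)⁻¹) * (1 + s ^ 2)⁻¹ * ‖ξ‖)
      (fun n => (orbit_integrable A hAc _ l hl ξ).aestronglyMeasurable)
      ((integrable_inv_one_add_sq.const_mul (1 + (l ^ 2)⁻¹)).mul_const ‖ξ‖) ?_ ?_
    · intro n
      refine Eventually.of_forall fun s => ?_
      rw [norm_smul, LinearIsometryEquiv.norm_map]
      gcongr
      exact kerAff_bound_real _ l hl s
    · refine Eventually.of_forall fun s => ?_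
      refine Tendsto.smul_const ?_ _
      have hc : Continuous fun a : ℝ => kerAff a l s := by
        unfold kerAff; fun_prop
      exact (hc.tendsto 0).comp tendsto_one_div_add_atTop_nhds_zero_nat
  have h0 : ∀ n : ℕ, ∫ s : ℝ, kerAff (1 / ((n : ℝ) + 1)) l s • A s ξ = 0 := fun n =>
    h _ (by positivity)
  simp only [h0] at ht
  exact (tendsto_nhds_unique ht tendsto_const_nhds)

/-- If all the smoothed vectors vanish, then the vector is fixed. -/
theorem fixed_of_vanish (A : ℝ → (H ≃ₗᵢ[ℂ] H))
    (hA : ∀ s s' : ℝ, ∀ ξ : H, A (s + s') ξ = A s (A s' ξ))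
    (hAc : ∀ ξ : H, Continuous fun s : ℝ => A s ξ) (ξ : H)
    (hd : DifferentiableAt ℝ (fun s => A s ξ) 0)
    (h1 : ∀ l : ℝ, 0 < l → ∫ s : ℝ, kerAff 0 l s • A s ξ = 0)
    (h2 : ∀ l : ℝ, 0 < l → ∫ s : ℝ, kerAff 0 l s • A (-s) ξ = 0) (s : ℝ) : A s ξ = ξ := by
  obtain ⟨η, hη⟩ : ∃ η, HasDerivAt (fun s => A s ξ) η 0 := ⟨_, hd.hasDerivAt⟩
  have hder : ∀ s, HasDerivAt (fun s => A s ξ) (A s η) s := by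
    intro s
    have e : (fun u => A u ξ) = fun u => A s (A (u - s) ξ) := by
      ext u; rw [← hA]; congr 2; ring
    rw [e]
    have h3 : HasDerivAt (fun u => A (u - s) ξ) η s := by
      have : HasDerivAt (fun s => A s ξ) η (s - s) := by simpa using hη
      exact this.comp_sub_const s s
    exact ((A s).toContinuousLinearEquiv.toContinuousLinearMap.restrictScalars ℝ).hasFDerivAt.comp_hasDerivAt s h3
  have hq0 : ∀ l : ℝ, 0 < l → ∫ s : ℝ, (s ^ 2 + l ^ 2)⁻¹ • A s η = 0 := by
    intro l hl
    have hpos : ∀ s : ℝ, 0 < s ^ 2 + l ^ 2 := fun s => by positivity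
    have hker : ∀ s : ℝ, ((I / (2 * l)) * (kerAff 0 l ((-s : ℝ) : ℂ) - kerAff 0 l s)) =
        ((-(2 * s) / (s ^ 2 + l ^ 2) ^ 2 : ℝ) : ℂ) := by
      intro s
      have n1 : ((s:ℂ) + l * I) ^ 2 ≠ 0 := kerAff_ne l hl s (by simp)
      have n2 : (-(s:ℂ) + l * I) ^ 2 ≠ 0 := by
        simpa using kerAff_ne l hl ((-s : ℝ) : ℂ) (by simp)
      have n1' : ((s:ℂ) + l * I) ≠ 0 := fun h => n1 (by rw [h]; simp)
      have n2' : (-(s:ℂ) + l * I) ≠ 0 := fun h => n2 (by rw [h]; simp)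
      have n3 : ((s:ℂ) ^ 2 + (l:ℂ) ^ 2) = -(((s:ℂ) + l * I) * (-(s:ℂ) + l * I)) := by
        ring_nf; rw [Complex.I_sq]; ring
      have nl : (l : ℂ) ≠ 0 := by exact_mod_cast hl.ne'
      unfold kerAff
      push_cast
      rw [n3]
      simp only [zero_mul, Complex.exp_zero, one_mul]
      have n4 : ((s:ℂ) + l * I) ^ 2 - (-(s:ℂ) + l * I) ^ 2 = 4 * s * l * I := by ring
      generalize ((s:ℂ) + l * I) = u at *
      generalize (-(s:ℂ) + l * I) = w at *
      have n5 : (w ^ 2)⁻¹ - (u ^ 2)⁻¹ = (u ^ 2 - w ^ 2) / (-(u * w)) ^ 2 := by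
        field_simp
      rw [n5, n4]
      field_simp
      rw [Complex.I_sq]
      ring
    have hi1 := orbit_integrable A hAc 0 l hl ξ
    have hi2 := orbit_integrable (fun s => A (-s)) (fun v => (hAc v).comp continuous_neg) 0 l hl ξ
    have hi2' : Integrable (fun s : ℝ => kerAff 0 l ((-s : ℝ) : ℂ) • A s ξ) := by
      simpa using hi2.comp_neg
    have hz2 : ∫ s : ℝ, kerAff 0 l ((-s : ℝ) : ℂ) • A s ξ = 0 := by
      rw [← h2 l hl, ← integral_neg_eq_self]
      simp
    have hfun : (fun s : ℝ => (-(2 * s) / (s ^ 2 + l ^ 2) ^ 2) • A s ξ) =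
        fun s : ℝ => (I / (2 * l)) • (kerAff 0 l ((-s : ℝ) : ℂ) • A s ξ - kerAff 0 l s • A s ξ) := by
      ext s
      rw [← sub_smul, smul_smul, hker, Complex.coe_smul]
    have hint1 : Integrable (fun s : ℝ => (-(2 * s) / (s ^ 2 + l ^ 2) ^ 2) • A s ξ) := by
      rw [hfun]; exact (hi2'.sub hi1).smul _
    have hzero1 : ∫ s : ℝ, (-(2 * s) / (s ^ 2 + l ^ 2) ^ 2) • A s ξ = 0 := by
      rw [hfun, integral_smul, integral_sub hi2' hi1, hz2, h1 l hl]; simp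
    have hqle : ∀ s : ℝ, (s ^ 2 + l ^ 2)⁻¹ ≤ (1 + (l ^ 2)⁻¹) * (1 + s ^ 2)⁻¹ := by
      intro s
      rw [← div_eq_mul_inv, inv_eq_one_div, div_le_div_iff₀ (hpos s) (by positivity)]
      have : (1 + (l ^ 2)⁻¹) * (s ^ 2 + l ^ 2) = s ^ 2 + l ^ 2 + (l^2)⁻¹ * s ^ 2 + 1 := by
        field_simp; ring
      rw [this]
      have : 0 ≤ (l^2)⁻¹ * s ^ 2 := by positivity
      nlinarith
    have hqc : Continuous fun s : ℝ => (s ^ 2 + l ^ 2)⁻¹ :=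
      Continuous.inv₀ (by fun_prop) fun s => (hpos s).ne'
    have hint2 : Integrable (fun s : ℝ => (s ^ 2 + l ^ 2)⁻¹ • A s η) := by
      refine Integrable.mono' ((integrable_inv_one_add_sq.const_mul (1 + (l ^ 2)⁻¹)).mul_const ‖η‖)
        (hqc.smul (hAc η)).aestronglyMeasurable ?_
      refine Eventually.of_forall fun s => ?_
      rw [norm_smul, LinearIsometryEquiv.norm_map, Real.norm_of_nonneg (by positivity)]
      gcongr
      exact hqle s
    have htend : ∀ L : Filter ℝ, Tendsto (fun s : ℝ => s ^ 2) L atTop →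
        Tendsto (fun s : ℝ => (s ^ 2 + l ^ 2)⁻¹ • A s ξ) L (𝓝 0) := by
      intro L hL
      have h3 : Tendsto (fun s : ℝ => (s ^ 2 + l ^ 2)⁻¹ * ‖ξ‖) L (𝓝 0) := by
        simpa using (tendsto_inv_atTop_zero.comp
          (tendsto_atTop_add_const_right _ (l ^ 2) hL)).mul_const ‖ξ‖
      refine squeeze_zero_norm (fun s => ?_) h3
      rw [norm_smul, LinearIsometryEquiv.norm_map, Real.norm_of_nonneg (by positivity)]
    have htot := integral_of_hasDerivAt_of_tendsto
      (f := fun s : ℝ => (s ^ 2 + l ^ 2)⁻¹ • A s ξ)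
      (f' := fun s : ℝ => (s ^ 2 + l ^ 2)⁻¹ • A s η + (-(2 * s) / (s ^ 2 + l ^ 2) ^ 2) • A s ξ)
      (fun s => by
        have hq : HasDerivAt (fun s : ℝ => (s ^ 2 + l ^ 2)⁻¹) (-(2 * s) / (s ^ 2 + l ^ 2) ^ 2) s := by
          have := ((hasDerivAt_pow 2 s).add_const (l ^ 2)).fun_inv (hpos s).ne'
          refine this.congr_deriv ?_
          norm_num
        exact hq.smul (hder s)) (hint2.add hint1)
      (htend atBot (by simpa [Function.comp_def] using
        (tendsto_pow_atTop (α := ℝ) two_ne_zero).comp tendsto_neg_atBot_atTop))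
      (htend atTop (tendsto_pow_atTop two_ne_zero))
    rw [integral_add hint2 hint1, hzero1] at htot
    simpa using htot
  have hη0 : η = 0 := by
    have hq1 : ∀ l : ℝ, 0 < l → ∫ u : ℝ, (1 + u ^ 2)⁻¹ • A (l * u) η = 0 := by
      intro l hl
      have h3 := Measure.integral_comp_mul_left (fun s : ℝ => (s ^ 2 + l ^ 2)⁻¹ • A s η) l
      rw [hq0 l hl, smul_zero] at h3
      have h4 : (fun u : ℝ => (1 + u ^ 2)⁻¹ • A (l * u) η) =
          fun u : ℝ => (l ^ 2) • (((l * u) ^ 2 + l ^ 2)⁻¹ • A (l * u) η) := by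
        ext u
        rw [smul_smul]
        congr 1
        have : 0 < 1 + u ^ 2 := by positivity
        rw [show (l * u) ^ 2 + l ^ 2 = l ^ 2 * (1 + u ^ 2) by ring]
        field_simp
      rw [h4, integral_smul, h3, smul_zero]
    have ht : Tendsto (fun n : ℕ => ∫ u : ℝ, (1 + u ^ 2)⁻¹ • A ((1 / ((n : ℝ) + 1)) * u) η) atTop
        (𝓝 (∫ u : ℝ, (1 + u ^ 2)⁻¹ • A 0 η)) := by
      have hqc : Continuous fun s : ℝ => (1 + s ^ 2)⁻¹ :=
        Continuous.inv₀ (by fun_prop) fun s => by positivity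
      refine tendsto_integral_of_dominated_convergence (fun s => (1 + s ^ 2)⁻¹ * ‖η‖)
        (fun n => (hqc.smul ((hAc η).comp (by fun_prop :
          Continuous fun u : ℝ => (1 / ((n : ℝ) + 1)) * u))).aestronglyMeasurable)
        (integrable_inv_one_add_sq.mul_const ‖η‖) ?_ ?_
      · intro n
        refine Eventually.of_forall fun s => ?_
        rw [norm_smul, LinearIsometryEquiv.norm_map, Real.norm_of_nonneg (by positivity)]
      · refine Eventually.of_forall fun s => ?_
        refine Tendsto.const_smul ?_ _
        have h5 : Tendsto (fun n : ℕ => (1 / ((n : ℝ) + 1)) * s) atTop (𝓝 0) := by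
          simpa using tendsto_one_div_add_atTop_nhds_zero_nat.mul_const s
        exact ((hAc η).tendsto 0).comp h5
    have h0 : ∀ n : ℕ, ∫ u : ℝ, (1 + u ^ 2)⁻¹ • A ((1 / ((n : ℝ) + 1)) * u) η = 0 := fun n =>
      hq1 _ (by positivity)
    simp only [h0] at ht
    have h6 := tendsto_nhds_unique ht tendsto_const_nhds
    rw [integral_smul_const, integral_univ_inv_one_add_sq, grp_zero A hA] at h6
    exact (smul_eq_zero.1 h6).resolve_left Real.pi_pos.ne'
  have hconst := is_const_of_deriv_eq_zero (f := fun s => A s ξ)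
    (fun s => (hder s).differentiableAt) (fun s => by rw [(hder s).deriv, hη0, map_zero]) s 0
  simpa [grp_zero A hA] using hconst

end

end AffHelpers

/-- Theorem on the affine group of the real line: for a unitary representation of
`Aff(ℝ)ₑ` (given by one-parameter unitary groups `A`, `B` with `B(t)A(s)B(-t) = A(eᵗs)`)
with no nonzero `A`-fixed vectors, an analytic vector `ξ` whose `B`-orbit map extends
holomorphically to a strip of half-width `r > π/2` with analytic-vector values on the
imaginary axis must vanish. -/
theorem stmt18 {H : Type*} [NormedAddCommGroup H] [InnerProductSpace ℂ H] [CompleteSpace H]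
    (A B : ℝ → (H ≃ₗᵢ[ℂ] H))
    (hA : ∀ s s' : ℝ, ∀ ξ : H, A (s + s') ξ = A s (A s' ξ))
    (hB : ∀ t t' : ℝ, ∀ ξ : H, B (t + t') ξ = B t (B t' ξ))
    (hAc : ∀ ξ : H, Continuous fun s : ℝ => A s ξ)
    (hBc : ∀ ξ : H, Continuous fun t : ℝ => B t ξ)
    (hcov : ∀ s t : ℝ, ∀ ξ : H, B t (A s (B (-t) ξ)) = A (Real.exp t * s) ξ)
    (hfix : ∀ ξ : H, (∀ s : ℝ, A s ξ = ξ) → ξ = 0)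
    (ξ : H)
    (hξan : ∀ p : ℝ × ℝ, AnalyticAt ℝ (fun q : ℝ × ℝ => A q.1 (B q.2 ξ)) p)
    (r : ℝ) (hr : Real.pi / 2 < r)
    (F : ℂ → H)
    (hFc : ContinuousOn F {z : ℂ | |z.im| ≤ r})
    (hFh : DifferentiableOn ℂ F {z : ℂ | |z.im| < r})
    (hFt : ∀ t : ℝ, F (t : ℂ) = B t ξ)
    (hFan : ∀ t : ℝ, |t| < r →
      ∀ p : ℝ × ℝ, AnalyticAt ℝ (fun q : ℝ × ℝ => A q.1 (B q.2 (F ((t : ℂ) * Complex.I)))) p) :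
    ξ = 0 := by
  have hslice : ∀ v : H, (∀ p : ℝ × ℝ, AnalyticAt ℝ (fun q : ℝ × ℝ => A q.1 (B q.2 v)) p) →
      AnalyticAt ℝ (fun s => A s v) 0 := by
    intro v hv
    have h1 := (hv (0, 0)).comp_of_eq (g := fun q : ℝ × ℝ => A q.1 (B q.2 v))
      (f := fun s : ℝ => ((s, 0) : ℝ × ℝ)) (x := 0) (by fun_prop) rfl
    have e : ((fun q : ℝ × ℝ => A q.1 (B q.2 v)) ∘ fun s : ℝ => ((s, 0) : ℝ × ℝ)) =
        fun s => A s v := by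
      ext s; simp [grp_zero B hB]
    rwa [e] at h1
  have hneg : ∀ v : H, AnalyticAt ℝ (fun s => A s v) 0 → AnalyticAt ℝ (fun s => A (-s) v) 0 := by
    intro v hv
    exact hv.comp_of_eq (f := fun s : ℝ => -s) (x := 0) (by fun_prop) (by simp)
  refine hfix ξ (fixed_of_vanish A hA hAc ξ (hslice ξ hξan).differentiableAt ?_ ?_)
  · intro l hl
    refine smooth_vanish_zero A hAc ξ l hl fun a ha => ?_
    exact smooth_vanish A B hA hB hAc hcov ξ r hr F hFh hFt
      (fun t ht => hslice _ (hFan t ht)) a l ha hl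
  · intro l hl
    have hAc' : ∀ ξ : H, Continuous fun s : ℝ => A (-s) ξ := fun v => (hAc v).comp continuous_neg
    refine smooth_vanish_zero (fun s => A (-s)) hAc' ξ l hl fun a ha => ?_
    refine smooth_vanish (fun s => A (-s)) B ?_ hB hAc' ?_ ξ r hr F hFh hFt
      (fun t ht => hneg _ (hslice _ (hFan t ht))) a l ha hl
    · intro s s' v
      rw [neg_add, hA]
    · intro s t v
      rw [hcov, mul_neg]
end
end

section
/- Let H be a complex Hilbert space and (U_t)_{t∈ℝ} a strongly continuous one-parameter group of unitary operators on H. Let ξ ∈ H and suppose F : S̄_{0,π} → H satisfies F(t) = U_t ξ for all t ∈ ℝ and is a weakly continuous, weakly holomorphic extension: for every v ∈ H the function z ↦ ⟨v, F(z)⟩ is continuous on S̄_{0,π} and holomorphic on S_{0,π}. Then F is norm-continuous on S̄_{0,π} and holomorphic as an H-valued map on S_{0,π} (complex differentiable at every interior point). In particular, the positive-definite function ψ_ξ(t) = ⟨ξ, U_t ξ⟩ extends continuously to S̄_{0,2π}, holomorphically on the interior, and ⟨F(w), F(z)⟩ = ψ_ξ(z − w̄) for z, w ∈ S̄_{0,π}.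 -/
open Complex
open scoped ComplexInnerProductSpace

noncomputable section

/-- The closed horizontal strip `{z : ℂ | a ≤ Im z ≤ b}`. -/
def closedStrip (a b : ℝ) : Set ℂ := {z : ℂ | a ≤ z.im ∧ z.im ≤ b}

/-- The open horizontal strip `{z : ℂ | a < Im z < b}`. -/
def openStrip (a b : ℝ) : Set ℂ := {z : ℂ | a < z.im ∧ z.im < b}

lemma isOpen_openStrip (a b : ℝ) : IsOpen (openStrip a b) :=
  (isOpen_lt continuous_const continuous_im).inter (isOpen_lt continuous_im continuous_const)

/-- Vanishing at points close to the lower boundary line. -/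
lemma strip_zero_near {a b : ℝ} {g : ℂ → ℂ} (hc : ContinuousOn g (closedStrip a b))
    (hd : DifferentiableOn ℂ g (openStrip a b)) (h0 : ∀ z : ℂ, z.im = a → g z = 0)
    (p : ℂ) (h1 : a < p.im) (h2 : 2 * (p.im - a) ≤ b - a) : g p = 0 := by
  set r : ℝ := p.im - a with hr
  have hrpos : 0 < r := by linarith
  let V : Set ℂ := {z | |z.re| < r ∧ |z.im| < r}
  let W : Set ℂ := {z | |z.re| ≤ r ∧ |z.im| ≤ r}
  have hVo : IsOpen V := (isOpen_lt continuous_re.abs continuous_const).inter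
    (isOpen_lt continuous_im.abs continuous_const)
  have hWc : IsClosed W := (isClosed_le continuous_re.abs continuous_const).inter
    (isClosed_le continuous_im.abs continuous_const)
  have hVW : closure V ⊆ W := closure_minimal (fun z hz => ⟨hz.1.le, hz.2.le⟩) hWc
  have hbd : Bornology.IsBounded V := by
    refine (Metric.isBounded_iff_subset_closedBall 0).2 ⟨r + r, fun z hz => ?_⟩
    have := Complex.norm_le_abs_re_add_abs_im z
    have h3 := hz.1
    have h4 := hz.2
    simp only [Metric.mem_closedBall, dist_zero_right]
    linarith
  have key : ∀ c : ℂ, (∀ z ∈ V, |(c * z).im| < r) → (∀ z ∈ W, |(c * z).im| ≤ r) →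
      DiffContOnCl ℂ (fun z => g (p + c * z)) V := by
    intro c hcV hcW
    refine ⟨?_, ?_⟩
    · refine hd.comp (t := openStrip a b) (by fun_prop) ?_
      intro z hz
      have := abs_lt.1 (hcV z hz)
      constructor <;> rw [add_im] <;> linarith
    · refine hc.comp (t := closedStrip a b) (by fun_prop) ?_
      intro z hz
      have := abs_le.1 (hcW z (hVW hz))
      constructor <;> rw [add_im] <;> linarith
  have k1 := key 1 (fun z hz => by simpa using hz.2) (fun z hz => by simpa using hz.2)
  have k2 := key I (fun z hz => by simpa using hz.1) (fun z hz => by simpa using hz.1)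
  have k3 := key (-1) (fun z hz => by simpa using hz.2) (fun z hz => by simpa using hz.2)
  have k4 := key (-I) (fun z hz => by simpa using hz.1) (fun z hz => by simpa using hz.1)
  have K := ((k1.smul k2).smul k3).smul k4
  have h0V : (0 : ℂ) ∈ closure V := subset_closure ⟨by simpa using hrpos, by simpa using hrpos⟩
  have hfin := Complex.norm_le_of_forall_mem_frontier_norm_le (C := 0) hbd K (by
    intro z hz
    rw [hVo.frontier_eq] at hz
    obtain ⟨hz1, hz2⟩ := hz
    have hzW := hVW hz1
    have hcases : (z.re = r ∨ z.re = -r) ∨ (z.im = r ∨ z.im = -r) := by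
      by_contra hcon
      push Not at hcon
      apply hz2
      refine ⟨lt_of_le_of_ne hzW.1 ?_, lt_of_le_of_ne hzW.2 ?_⟩
      · intro h
        rcases (abs_eq hrpos.le).1 h with h | h
        · exact hcon.1.1 h
        · exact hcon.1.2 h
      · intro h
        rcases (abs_eq hrpos.le).1 h with h | h
        · exact hcon.2.1 h
        · exact hcon.2.2 h
    rcases hcases with (h | h) | (h | h)
    · have : g (p + -I * z) = 0 := h0 _ (by simp [h, hr])
      simp only [smul_eq_mul, this]; simp
    · have : g (p + I * z) = 0 := h0 _ (by simp [h, hr])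
      simp only [smul_eq_mul, this]; simp
    · have : g (p + -1 * z) = 0 := h0 _ (by simp [h, hr])
      simp only [smul_eq_mul, this]; simp
    · have : g (p + 1 * z) = 0 := h0 _ (by simp [h, hr])
      simp only [smul_eq_mul, this]; simp) h0V
  simp only [smul_eq_mul, mul_zero, add_zero] at hfin
  have h9 := norm_le_zero_iff.1 hfin
  simpa using h9

/-- A function continuous on a closed strip, holomorphic inside and zero on the lower line
vanishes. -/
lemma strip_zero {a b : ℝ} {g : ℂ → ℂ} (hc : ContinuousOn g (closedStrip a b))
    (hd : DifferentiableOn ℂ g (openStrip a b)) (h0 : ∀ z : ℂ, z.im = a → g z = 0) :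
    ∀ z ∈ closedStrip a b, g z = 0 := by
  intro z hz
  rcases hz.1.eq_or_lt with h | h
  · exact h0 z h.symm
  have hab : a < b := lt_of_lt_of_le h hz.2
  have hopen : ∀ z ∈ openStrip a b, g z = 0 := by
    have han := hd.analyticOnNhd (isOpen_openStrip a b)
    have hconv : Convex ℝ (openStrip a b) :=
      (convex_halfSpace_im_gt a).inter (convex_halfSpace_im_lt b)
    let q : ℂ := ((a + (b - a) / 4 : ℝ) : ℂ) * I
    have hq : q.im = a + (b - a) / 4 := by simp [q]
    have hqm : q ∈ openStrip a b := by
      constructor <;> rw [hq] <;> linarith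
    refine han.eqOn_zero_of_preconnected_of_eventuallyEq_zero hconv.isPreconnected hqm ?_
    have hm : openStrip a (a + (b - a) / 2) ∈ nhds q :=
      (isOpen_openStrip _ _).mem_nhds (by constructor <;> rw [hq] <;> linarith)
    filter_upwards [hm] with w hw
    have := hw.2
    exact strip_zero_near hc hd h0 w hw.1 (by linarith)
  rcases hz.2.eq_or_lt with hb1 | hb1
  swap
  · exact hopen z ⟨h, hb1⟩
  have hcl : z ∈ closure (openStrip a b) := by
    have hl : Filter.Tendsto (fun s : ℝ => z - (s : ℂ) * I) (nhdsWithin 0 (Set.Ioi 0)) (nhds z) := by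
      have : Continuous fun s : ℝ => z - (s : ℂ) * I := by fun_prop
      have h2 := this.tendsto 0
      simp only [ofReal_zero, zero_mul, sub_zero] at h2
      exact h2.mono_left nhdsWithin_le_nhds
    refine mem_closure_of_tendsto hl ?_
    have : Set.Ioo (0 : ℝ) (b - a) ∈ nhdsWithin (0 : ℝ) (Set.Ioi 0) :=
      Ioo_mem_nhdsGT (by linarith)
    filter_upwards [this] with s hs
    have h5 := hs.1
    have h6 := hs.2
    constructor <;> simp <;> linarith
  have hss : openStrip a b ⊆ closedStrip a b := fun w hw => ⟨hw.1.le, hw.2.le⟩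
  have hcw := (hc z hz).mono hss
  have : (nhdsWithin z (openStrip a b)).NeBot := mem_closure_iff_nhdsWithin_neBot.1 hcl
  refine tendsto_nhds_unique hcw.tendsto ?_
  refine tendsto_const_nhds.congr' ?_
  filter_upwards [self_mem_nhdsWithin] with w hw
  exact (hopen w hw).symm

lemma strip_eq {a b : ℝ} {f g : ℂ → ℂ} (hfc : ContinuousOn f (closedStrip a b))
    (hfd : DifferentiableOn ℂ f (openStrip a b)) (hgc : ContinuousOn g (closedStrip a b))
    (hgd : DifferentiableOn ℂ g (openStrip a b)) (h0 : ∀ z : ℂ, z.im = a → f z = g z) :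
    ∀ z ∈ closedStrip a b, f z = g z := fun z hz =>
  sub_eq_zero.1 (strip_zero (hfc.sub hgc) (hfd.sub hgd)
    (fun z hz => sub_eq_zero.2 (h0 z hz)) z hz)

/-- Norm-continuous and weakly holomorphic implies holomorphic. -/
lemma diff_of_weak {H : Type*} [NormedAddCommGroup H] [InnerProductSpace ℂ H] [CompleteSpace H]
    {F : ℂ → H} {s : Set ℂ} (hs : IsOpen s) (hc : ContinuousOn F s)
    (hd : ∀ v : H, DifferentiableOn ℂ (fun z : ℂ => ⟪v, F z⟫) s) : DifferentiableOn ℂ F s := by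
  intro c hcs
  obtain ⟨R, hR, hRs⟩ := Metric.nhds_basis_closedBall.mem_iff.1 (hs.mem_nhds hcs)
  have hci : CircleIntegrable F c R :=
    (hc.mono (Metric.sphere_subset_closedBall.trans hRs)).circleIntegrable hR.le
  lift R to NNReal using hR.le
  have hps := hasFPowerSeriesOn_cauchy_integral hci (by exact_mod_cast hR)
  have hdiff := hps.differentiableOn
  have heq : ∀ w ∈ Metric.ball c R,
      F w = (2 * Real.pi * I : ℂ)⁻¹ • ∮ z in C(c, R), (z - w)⁻¹ • F z := by
    intro w hw
    refine ext_inner_left ℂ fun v => ?_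
    have h1 := ((hd v).mono hRs).circleIntegral_sub_inv_smul hw
    have hci2 : CircleIntegrable (fun z => (z - w)⁻¹ • F z) c R := by
      refine ContinuousOn.circleIntegrable hR.le ?_
      refine ContinuousOn.smul (ContinuousOn.inv₀ (by fun_prop) ?_)
        (hc.mono (Metric.sphere_subset_closedBall.trans hRs))
      intro z hz h
      rw [sub_eq_zero] at h
      subst h
      exact absurd hw (by simp [Metric.mem_sphere.1 hz])
    have h2 : ⟪v, ∮ z in C(c, R), (z - w)⁻¹ • F z⟫
        = ∮ z in C(c, R), (z - w)⁻¹ • ⟪v, F z⟫ := by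
      unfold circleIntegral
      have := (innerSL ℂ v).intervalIntegral_comp_comm hci2.out
      simp only [innerSL_apply_apply, inner_smul_right] at this
      simp only [smul_eq_mul, this, inner_smul_right]
    rw [inner_smul_right, h2, h1, smul_eq_mul, inv_mul_cancel_left₀]
    simp [Real.pi_ne_zero]
  have hmem : Metric.ball c (R : ℝ) ∈ nhds c := Metric.ball_mem_nhds c hR
  refine DifferentiableAt.differentiableWithinAt ?_
  have hd0 := hdiff.differentiableAt (x := c) (by
    rw [Metric.eball_coe]; exact hmem)
  refine hd0.congr_of_eventuallyEq ?_
  filter_upwards [hmem] with w hw using heq w hw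

theorem stmt19 {H : Type*} [NormedAddCommGroup H] [InnerProductSpace ℂ H] [CompleteSpace H]
    (U : ℝ → (H ≃ₗᵢ[ℂ] H))
    (hU : ∀ s t : ℝ, ∀ v : H, U (s + t) v = U s (U t v))
    (hUc : ∀ v : H, Continuous fun t : ℝ => U t v)
    (ξ : H) (F : ℂ → H)
    (hFt : ∀ t : ℝ, F (t : ℂ) = U t ξ)
    (hFwc : ∀ v : H, ContinuousOn (fun z : ℂ => ⟪v, F z⟫) (closedStrip 0 Real.pi))
    (hFwh : ∀ v : H, DifferentiableOn ℂ (fun z : ℂ => ⟪v, F z⟫) (openStrip 0 Real.pi)) :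
    ContinuousOn F (closedStrip 0 Real.pi) ∧
    DifferentiableOn ℂ F (openStrip 0 Real.pi) ∧
    ∃ ψ : ℂ → ℂ,
      ContinuousOn ψ (closedStrip 0 (2 * Real.pi)) ∧
      DifferentiableOn ℂ ψ (openStrip 0 (2 * Real.pi)) ∧
      (∀ t : ℝ, ψ (t : ℂ) = ⟪ξ, U t ξ⟫) ∧
      ∀ z ∈ closedStrip 0 Real.pi, ∀ w ∈ closedStrip 0 Real.pi,
        ⟪F w, F z⟫ = ψ (z - (starRingEnd ℂ) w) := by
  have hpi := Real.pi_pos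
  have hU0 : ∀ v : H, U 0 v = v := by
    intro v
    have h := hU 0 0 v
    rw [add_zero] at h
    exact ((U 0).injective h).symm
  have hadj : ∀ (t : ℝ) (v x : H), ⟪v, U t x⟫ = ⟪U (-t) v, x⟫ := by
    intro t v x
    rw [← (U (-t)).inner_map_map v (U t x), ← hU, neg_add_cancel, hU0]
  have hreal : ∀ z : ℂ, z.im = 0 → F z = U z.re ξ := by
    intro z hz
    rw [← hFt]
    congr 1
    apply Complex.ext <;> simp [hz]
  -- translation along the real axis
  have hshift : ∀ (t : ℝ) (v : H), ∀ z ∈ closedStrip 0 Real.pi,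
      ⟪v, F (z + t)⟫ = ⟪U (-t) v, F z⟫ := by
    intro t v
    refine strip_eq ?_ ?_ (hFwc _) (hFwh _) ?_
    · refine (hFwc v).comp (t := closedStrip 0 Real.pi) (f := fun z : ℂ => z + t) (by fun_prop) ?_
      intro z hz
      simpa [closedStrip] using hz
    · refine (hFwh v).comp (t := openStrip 0 Real.pi) (f := fun z : ℂ => z + t) (by fun_prop) ?_
      intro z hz
      simpa [openStrip] using hz
    · intro z hz
      rw [hreal z hz, hreal (z + t) (by simp [hz]), ← hadj, ← hU]
      simp [add_comm]
  -- reflection symmetry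
  have hrefl : ∀ z ∈ closedStrip 0 Real.pi,
      ⟪F (-(starRingEnd ℂ) z), ξ⟫ = ⟪ξ, F z⟫ := by
    have hmap : ∀ z ∈ closedStrip 0 Real.pi, -(starRingEnd ℂ) z ∈ closedStrip 0 Real.pi := by
      intro z hz
      simpa [closedStrip] using hz
    have hconj : (fun z : ℂ => ⟪F (-(starRingEnd ℂ) z), ξ⟫)
        = (starRingEnd ℂ) ∘ (fun z => ⟪ξ, F (-z)⟫) ∘ (starRingEnd ℂ) := by
      funext z
      simp [inner_conj_symm]
    refine strip_eq ?_ ?_ (hFwc _) (hFwh _) ?_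
    · rw [hconj]
      refine Complex.continuous_conj.comp_continuousOn ?_
      exact (hFwc ξ).comp (f := fun z : ℂ => -(starRingEnd ℂ) z)
        (Complex.continuous_conj.neg.continuousOn) hmap
    · intro z hz
      rw [hconj]
      refine DifferentiableAt.differentiableWithinAt ?_
      have hz' : -(starRingEnd ℂ) z ∈ openStrip 0 Real.pi := by
        simpa [openStrip] using hz
      have h1 : DifferentiableAt ℂ (fun z : ℂ => ⟪ξ, F z⟫) (-(starRingEnd ℂ) z) :=
        (hFwh ξ).differentiableAt ((isOpen_openStrip _ _).mem_nhds hz')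
      have h2 : DifferentiableAt ℂ (fun z : ℂ => ⟪ξ, F (-z)⟫) ((starRingEnd ℂ) z) :=
        DifferentiableAt.comp (g := fun z : ℂ => ⟪ξ, F z⟫) ((starRingEnd ℂ) z) h1
          (differentiableAt_id.neg)
      have h3 := h2.conj_conj
      rwa [Complex.conj_conj] at h3
    · intro z hz
      rw [hreal z hz, hreal _ (by simp [hz]), hadj]
      simp
  -- general: holomorphy of shifted weak functions
  have hcs : ∀ (v : H) (a b : ℝ) (d : ℂ), 0 ≤ a + d.im → b + d.im ≤ Real.pi →
      ContinuousOn (fun z : ℂ => ⟪v, F (z + d)⟫) (closedStrip a b) := by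
    intro v a b d h1 h2
    refine (hFwc v).comp (t := closedStrip 0 Real.pi) (f := fun z : ℂ => z + d) (by fun_prop) ?_
    intro z hz
    have h3 := hz.1
    have h4 := hz.2
    constructor <;> simp <;> linarith
  have hds : ∀ (v : H) (a b : ℝ) (d : ℂ), 0 ≤ a + d.im → b + d.im ≤ Real.pi →
      DifferentiableOn ℂ (fun z : ℂ => ⟪v, F (z + d)⟫) (openStrip a b) := by
    intro v a b d h1 h2
    refine (hFwh v).comp (t := openStrip 0 Real.pi) (f := fun z : ℂ => z + d) (by fun_prop) ?_
    intro z hz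
    have h3 := hz.1
    have h4 := hz.2
    constructor <;> simp <;> linarith
  -- first half of the kernel identity
  have hK1 : ∀ w ∈ closedStrip 0 Real.pi, ∀ z ∈ closedStrip 0 (Real.pi - w.im),
      ⟪F w, F z⟫ = ⟪ξ, F (z + -(starRingEnd ℂ) w)⟫ := by
    intro w hw
    have hw1 := hw.1
    have hw2 := hw.2
    refine strip_eq ?_ ?_ (hcs _ _ _ _ (by simpa using hw1) (by simp))
      (hds _ _ _ _ (by simpa using hw1) (by simp)) ?_
    · simpa using hcs (F w) 0 (Real.pi - w.im) 0 (by simp) (by simpa using hw1)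
    · simpa using hds (F w) 0 (Real.pi - w.im) 0 (by simp) (by simpa using hw1)
    · intro z hz
      rw [← hrefl _ (by constructor <;> simp [hz, hw1, hw2])]
      have hzz : -(starRingEnd ℂ) (z + -(starRingEnd ℂ) w) = w + ((-z.re : ℝ) : ℂ) := by
        apply Complex.ext <;> simp [hz]
      rw [hzz, ← inner_conj_symm, ← inner_conj_symm (F (w + _)), hshift _ _ w hw, hreal z hz,
        neg_neg]
  have hpiI : ((Real.pi : ℂ) * I) ∈ closedStrip 0 Real.pi := by
    constructor <;> simp [hpi.le]
  have hK2 : ∀ w ∈ closedStrip 0 Real.pi, ∀ z ∈ closedStrip (Real.pi - w.im) Real.pi,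
      ⟪F w, F z⟫ = ⟪F ((Real.pi : ℂ) * I), F (z + (-(starRingEnd ℂ) w - (Real.pi : ℂ) * I))⟫ := by
    intro w hw
    have hw1 := hw.1
    have hw2 := hw.2
    refine strip_eq ?_ ?_ (hcs _ _ _ _ (by simp) (by simpa using hw2))
      (hds _ _ _ _ (by simp) (by simpa using hw2)) ?_
    · simpa using hcs (F w) (Real.pi - w.im) Real.pi 0 (by simpa using hw2) (by simp)
    · simpa using hds (F w) (Real.pi - w.im) Real.pi 0 (by simpa using hw2) (by simp)
    · intro z hz
      rw [hK1 w hw z ⟨by rw [hz]; linarith, hz.le⟩, hK1 _ hpiI _ (by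
        constructor <;> simp [hz])]
      congr 2
      simp
      ring
  let ψ : ℂ → ℂ := fun ζ => if ζ.im ≤ Real.pi then ⟪ξ, F ζ⟫
    else ⟪F ((Real.pi : ℂ) * I), F (ζ + (-((Real.pi : ℂ) * I)))⟫
  have hψ : ∀ z ∈ closedStrip 0 Real.pi, ∀ w ∈ closedStrip 0 Real.pi,
        ⟪F w, F z⟫ = ψ (z - (starRingEnd ℂ) w) := by
    intro z hz w hw
    by_cases h : (z - (starRingEnd ℂ) w).im ≤ Real.pi
    · simp only [ψ, if_pos h]
      simp only [sub_im, conj_im] at h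
      rw [hK1 w hw z ⟨hz.1, by linarith⟩, sub_eq_add_neg]
    · simp only [ψ, if_neg h]
      simp only [sub_im, conj_im] at h
      rw [hK2 w hw z ⟨by linarith, hz.2⟩]
      congr 2
      ring
  have h0 : F 0 = ξ := by
    have := hFt 0
    rwa [ofReal_zero, hU0] at this
  have hclosed : ∀ a b : ℝ, IsClosed (closedStrip a b) := fun a b =>
    (isClosed_le continuous_const continuous_im).inter (isClosed_le continuous_im continuous_const)
  have hψc : ContinuousOn ψ (closedStrip 0 (2 * Real.pi)) := by
    have c1 : ContinuousOn ψ (closedStrip 0 Real.pi) :=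
      (hFwc ξ).congr fun z hz => if_pos hz.2
    have c2 : ContinuousOn ψ (closedStrip Real.pi (2 * Real.pi)) := by
      refine (hcs (F ((Real.pi : ℂ) * I)) Real.pi (2 * Real.pi) (-((Real.pi : ℂ) * I))
        (by simp) (by simp; linarith)).congr fun z hz => ?_
      have hz1 := hz.1
      have hz2 := hz.2
      have := hψ (z + (-((Real.pi : ℂ) * I))) (by constructor <;> simp <;> linarith) _ hpiI
      refine Eq.trans ?_ this.symm
      congr 1
      simp
    refine (c1.union_of_isClosed c2 (hclosed _ _) (hclosed _ _)).mono fun z hz => ?_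
    rcases le_total z.im Real.pi with h | h
    · exact Or.inl ⟨hz.1, h⟩
    · exact Or.inr ⟨h, hz.2⟩
  have hψd : DifferentiableOn ℂ ψ (openStrip 0 (2 * Real.pi)) := by
    intro ζ hζ
    have hζ1 := hζ.1
    have hζ2 := hζ.2
    let w : ℂ := ((ζ.im / 2 : ℝ) : ℂ) * I
    have hwim : w.im = ζ.im / 2 := by simp [w]
    have hw : w ∈ closedStrip 0 Real.pi := by constructor <;> rw [hwim] <;> linarith
    have hmem : openStrip (ζ.im / 2) (Real.pi + ζ.im / 2) ∈ nhds ζ :=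
      (isOpen_openStrip _ _).mem_nhds (by constructor <;> linarith)
    have hd := (hds (F w) (ζ.im / 2) (Real.pi + ζ.im / 2) ((starRingEnd ℂ) w)
      (by simp [hwim]) (by simp [hwim])).differentiableAt hmem
    refine (hd.congr_of_eventuallyEq ?_).differentiableWithinAt
    filter_upwards [hmem] with z hz
    have hz1 := hz.1
    have hz2 := hz.2
    rw [hψ _ (by constructor <;> simp [hwim] <;> linarith) w hw]
    congr 1
    ring
  have hFc : ContinuousOn F (closedStrip 0 Real.pi) := by
    intro w hw
    have hsub : ∀ z ∈ closedStrip 0 Real.pi, ∀ w ∈ closedStrip 0 Real.pi,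
        z - (starRingEnd ℂ) w ∈ closedStrip 0 (2 * Real.pi) := by
      intro z hz w hw
      have h1 := hz.1
      have h2 := hz.2
      have h3 := hw.1
      have h4 := hw.2
      constructor <;> simp <;> linarith
    have e1 : ContinuousOn (fun z => ψ (z - (starRingEnd ℂ) z)) (closedStrip 0 Real.pi) :=
      hψc.comp (f := fun z : ℂ => z - (starRingEnd ℂ) z)
        (continuous_id.sub Complex.continuous_conj).continuousOn (fun z hz => hsub z hz z hz)
    have e2 : ContinuousOn (fun z => ‖F z‖ ^ 2) (closedStrip 0 Real.pi) := by
      refine (Complex.continuous_re.comp_continuousOn e1).congr fun z hz => ?_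
      simp only [Function.comp_apply]
      rw [← hψ z hz z hz, inner_self_eq_norm_sq_to_K]
      norm_cast
    have e3 : ContinuousOn (fun z => ‖F z - F w‖ ^ 2) (closedStrip 0 Real.pi) := by
      have : ∀ z, ‖F z - F w‖ ^ 2 = ‖F z‖ ^ 2 - 2 * (⟪F w, F z⟫).re + ‖F w‖ ^ 2 := by
        intro z
        rw [norm_sub_sq (𝕜 := ℂ), inner_re_symm]
        rfl
      simp only [this]
      exact (e2.sub (continuousOn_const.mul
        (Complex.continuous_re.comp_continuousOn (hFwc (F w))))).add continuousOn_const
    have e4 := (Real.continuous_sqrt.comp_continuousOn e3) w hw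
    have e5 := e4.tendsto
    simp only [Function.comp_apply, sub_self, norm_zero, Real.sqrt_sq (norm_nonneg _)] at e5
    rw [ContinuousWithinAt, tendsto_iff_norm_sub_tendsto_zero]
    simpa [Function.comp_def, Real.sqrt_sq (norm_nonneg _)] using e5
  refine ⟨hFc, diff_of_weak (isOpen_openStrip _ _)
    (hFc.mono fun z hz => ⟨hz.1.le, hz.2.le⟩) hFwh, ψ, hψc, hψd, ?_, hψ⟩
  intro t
  have : ((t : ℂ)).im ≤ Real.pi := by simp [hpi.le]
  simp only [ψ, if_pos this, hFt]
end
end
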